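/- Let F_q be a finite field of odd order q. Suppose F ∈ F_q[t] is a monic polynomial of degree n ≥ 2. Then there exist absolute constants C₁, C₂ > 0 (independent of q, n, F) such that |R(F;q) − q^(n−1)/(n(n−1))| ≤ C₁·n!·(n−1)!·q^(n−3/2) + C₂·n·2^(binomial(n+2,2))·q^(n−2). -/

import Mathlib

open Polynomial

theorem pow_dvd_hasseDeriv_pow {R : Type*} [CommRing R] (f : R[X]) (l k : ℕ) :
    f ^ (l - k) ∣ hasseDeriv k (f ^ l) := by
  induction l generalizing k with
  | zero => simp
  | succ l ih =>
    rw [pow_succ, hasseDeriv_mul]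
    refine Finset.dvd_sum fun ij hij => ?_
    have hk := Finset.HasAntidiagonal.mem_antidiagonal.mp hij
    rcases Nat.eq_zero_or_pos ij.2 with h0 | h0
    · have : ij.1 = k := by omega
      rw [h0, hasseDeriv_zero', this]
      rcases Nat.lt_or_ge l k with h | h
      · simp [Nat.sub_eq_zero_of_le (show l + 1 ≤ k by omega)]
      · rw [Nat.succ_sub h, pow_succ]
        exact mul_dvd_mul_right (ih k) f
    · exact Dvd.dvd.mul_right ((pow_dvd_pow f (by omega)).trans (ih ij.1)) _

theorem pow_dvd_hasseDeriv_pow_mul {R : Type*} [CommRing R] (f u : R[X]) (l k : ℕ) :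
    f ^ (l - k) ∣ hasseDeriv k (f ^ l * u) := by
  rw [hasseDeriv_mul]
  refine Finset.dvd_sum fun ij hij => ?_
  have hk := Finset.HasAntidiagonal.mem_antidiagonal.mp hij
  exact Dvd.dvd.mul_right ((pow_dvd_pow f (by omega)).trans (pow_dvd_hasseDeriv_pow f l ij.1)) _

/-- A nonzero polynomial vanishing to order `M` on `S` has degree at least `M * #S`. -/
theorem mul_card_le_natDegree {K : Type*} [Field K] (g : K[X]) (hg : g ≠ 0) (S : Finset K) (M : ℕ)
    (h : ∀ α ∈ S, ∀ k < M, (hasseDeriv k g).eval α = 0) : M * S.card ≤ g.natDegree := by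
  have hdvd : ∀ α ∈ S, (X - C α) ^ M ∣ g := by
    intro α hα
    have h1 : X ^ M ∣ taylor α g := by
      rw [X_pow_dvd_iff]
      intro k hk
      rw [taylor_coeff]
      exact h α hα k hk
    obtain ⟨v, hv⟩ := h1
    refine ⟨taylor (-α) v, ?_⟩
    have h2 : taylor (-α) (taylor α g) = g := by rw [taylor_taylor]; simp
    rw [← h2, hv, taylor_mul, taylor_pow, taylor_X]
    simp [sub_eq_add_neg]
  have hprod : ∏ α ∈ S, (X - C α) ^ M ∣ g := by
    refine Finset.prod_dvd_of_coprime ?_ hdvd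
    intro α _ β _ hne
    exact (isCoprime_X_sub_C_of_isUnit_sub (sub_ne_zero.mpr hne).isUnit).pow
  have hle := natDegree_le_of_dvd hprod hg
  rw [natDegree_prod _ _ (fun α _ => pow_ne_zero _ (X_sub_C_ne_zero α))] at hle
  simpa [mul_comm] using hle

theorem eval_hasseDeriv_mul_X_pow {K : Type*} [Field K] [Fintype K] (u : K[X]) (α : K) (j k : ℕ)
    (hk : k < Fintype.card K) :
    (hasseDeriv k (u * X ^ (j * Fintype.card K))).eval α = (hasseDeriv k u).eval α * α ^ j := by
  set q := Fintype.card K with hq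
  have h1 : taylor α (X ^ (j * q) : K[X]) = (X ^ q + C α) ^ j := by
    obtain ⟨p, hp⟩ := CharP.exists K
    obtain ⟨n, hpp, hn⟩ := FiniteField.card K p
    have := Fact.mk hpp
    rw [taylor_X_pow, mul_comm, pow_mul]
    congr 1
    rw [hq, hn, add_pow_char_pow, ← C_pow, ← hn, FiniteField.pow_card]
  have h2 : (X : K[X]) ^ q ∣ (X ^ q + C α) ^ j - C α ^ j := by
    have := sub_dvd_pow_sub_pow ((X : K[X]) ^ q + C α) (C α) j
    simpa using this
  obtain ⟨v, hv⟩ := h2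
  rw [← taylor_coeff, ← taylor_coeff, taylor_mul, h1, sub_eq_iff_eq_add.mp hv, mul_add, coeff_add,
    ← C_pow, coeff_mul_C]
  have : (taylor α u * (X ^ q * v)).coeff k = 0 := by
    rw [mul_left_comm, coeff_X_pow_mul']
    simp [hk]
  rw [this, zero_add]

/-- The degrees of the blocks are pairwise distinct because `f` has odd degree. -/
theorem sum_blocks_ne_zero {K : Type*} [Field K] {f : K[X]} {q L J : ℕ}
    (hq : 2 * L + f.natDegree = q) (hodd : Odd f.natDegree) (e : ℕ) (he : 2 * e + 1 = q)
    (r s : Fin J → K[X]) (hr : ∀ j, r j ∈ degreeLT K L) (hs : ∀ j, s j ∈ degreeLT K L)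
    (hne : ∃ j, r j ≠ 0 ∨ s j ≠ 0) :
    ∑ j : Fin J, (r j + f ^ e * s j) * X ^ ((j : ℕ) * q) ≠ 0 := by
  obtain ⟨m, hm⟩ := hodd
  have hf0 : f ≠ 0 := by rintro rfl; simp at hm
  have hLpos : 0 < L := by
    obtain ⟨j, h⟩ := hne
    by_contra hL
    have hL : L = 0 := by omega
    subst hL
    have h1 := hr j
    have h2 := hs j
    rw [mem_degreeLT] at h1 h2
    simp at h1 h2
    rcases h with h | h <;> contradiction
  have hnd : ∀ u : K[X], u ∈ degreeLT K L → u ≠ 0 → u.natDegree < L := by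
    intro u hu h0
    rw [mem_degreeLT] at hu
    exact (natDegree_lt_iff_degree_lt h0).mpr hu
  let b : Fin J ⊕ Fin J → K[X] := Sum.elim (fun j => r j * X ^ ((j : ℕ) * q))
    (fun j => f ^ e * s j * X ^ ((j : ℕ) * q))
  have hsum : ∑ j : Fin J, (r j + f ^ e * s j) * X ^ ((j : ℕ) * q) = ∑ i, b i := by
    rw [Fintype.sum_sum_type]
    simp only [b, Sum.elim_inl, Sum.elim_inr, ← Finset.sum_add_distrib, add_mul]
  have hfe : f.natDegree * e = m * q + L := by
    have : 2 * (f.natDegree * e) = 2 * (m * q + L) := by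
      have h1 : 2 * e = q - 1 := by omega
      have h2 : f.natDegree * (2 * e) + f.natDegree = f.natDegree * q := by rw [← he]; ring
      have h3 : f.natDegree * q = 2 * (m * q) + q := by rw [hm]; ring
      nlinarith
    omega
  have hdl : ∀ j : Fin J, r j ≠ 0 → (b (.inl j)).natDegree = (r j).natDegree + j * q := by
    intro j h
    simp only [b, Sum.elim_inl]
    rw [natDegree_mul h (by simp), natDegree_X_pow]
  have hdr : ∀ j : Fin J, s j ≠ 0 →
      (b (.inr j)).natDegree = (L + (s j).natDegree) + (j + m) * q := by
    intro j h
    simp only [b, Sum.elim_inr]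
    rw [natDegree_mul (mul_ne_zero (pow_ne_zero _ hf0) h) (by simp), natDegree_X_pow,
      natDegree_mul (pow_ne_zero _ hf0) h, natDegree_pow, mul_comm e, hfe]
    ring
  have hbl : ∀ j, b (.inl j) ≠ 0 → r j ≠ 0 := by
    rintro j h h0; apply h; simp [b, h0]
  have hbr : ∀ j, b (.inr j) ≠ 0 → s j ≠ 0 := by
    rintro j h h0; apply h; simp [b, h0]
  have key : ∀ x y i j : ℕ, x < q → y < q → x + i * q = y + j * q → x = y ∧ i = j := by
    intro x y i j hx hy h
    have h1 := congrArg (· % q) h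
    simp only [Nat.add_mul_mod_self_right, Nat.mod_eq_of_lt hx, Nat.mod_eq_of_lt hy] at h1
    subst h1
    have h2 : i * q = j * q := by omega
    exact ⟨rfl, Nat.eq_of_mul_eq_mul_right (by omega) h2⟩
  have hpair : Set.Pairwise {i | i ∈ Finset.univ ∧ b i ≠ 0}
      (Function.onFun Ne (degree ∘ b)) := by
    rintro i ⟨-, hi⟩ j ⟨-, hj⟩ hij hdeg
    have hdeg' : (b i).natDegree = (b j).natDegree := natDegree_eq_of_degree_eq hdeg
    rcases i with i | i <;> rcases j with j | j
    · have h1 := hbl i hi; have h2 := hbl j hj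
      have h3 := hnd _ (hr i) h1; have h4 := hnd _ (hr j) h2
      rw [hdl i h1, hdl j h2] at hdeg'
      have := (key _ _ _ _ (by omega) (by omega) hdeg').2
      exact hij (congrArg _ (Fin.ext this))
    · have h1 := hbl i hi; have h2 := hbr j hj
      have h3 := hnd _ (hr i) h1; have h4 := hnd _ (hs j) h2
      rw [hdl i h1, hdr j h2] at hdeg'
      have := (key _ _ _ _ (by omega) (by omega) hdeg').1
      omega
    · have h1 := hbr i hi; have h2 := hbl j hj
      have h3 := hnd _ (hs i) h1; have h4 := hnd _ (hr j) h2
      rw [hdr i h1, hdl j h2] at hdeg'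
      have := (key _ _ _ _ (by omega) (by omega) hdeg').1
      omega
    · have h1 := hbr i hi; have h2 := hbr j hj
      have h3 := hnd _ (hs i) h1; have h4 := hnd _ (hs j) h2
      rw [hdr i h1, hdr j h2] at hdeg'
      have := (key _ _ _ _ (by omega) (by omega) hdeg').2
      exact hij (congrArg _ (Fin.ext (by omega)))
  rw [hsum]
  intro h0
  have hd := degree_sum_eq_of_disjoint b Finset.univ hpair
  rw [h0, degree_zero] at hd
  have hz : ∀ i, b i = 0 := by
    intro i
    have := Finset.le_sup (f := fun i => degree (b i)) (Finset.mem_univ i)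
    rw [← hd] at this
    exact degree_eq_bot.mp (le_bot_iff.mp this)
  obtain ⟨j, h | h⟩ := hne
  · have := hz (.inl j)
    simp [b, h] at this
  · have := hz (.inr j)
    simp [b, h, hf0] at this

theorem finrank_degreeLT (K : Type*) [Field K] (n : ℕ) :
    Module.finrank K (degreeLT K n) = n := by
  rw [(degreeLTEquiv K n).finrank_eq]; simp

/-- Linear algebra step of Stepanov's method: an auxiliary pair of coefficient vectors exists as
soon as the number of unknowns exceeds the number of conditions. -/
theorem exists_stepanov_coeffs {K : Type*} [Field K] (f : K[X]) (hf : f ≠ 0) (a : K)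
    (L e M J : ℕ)
    (hdim : 2 * M * (L + J) + f.natDegree * (M * (M - 1)) < 4 * J * L) :
    ∃ r s : Fin J → K[X], (∀ j, r j ∈ degreeLT K L) ∧ (∀ j, s j ∈ degreeLT K L) ∧
      (∃ j, r j ≠ 0 ∨ s j ≠ 0) ∧
      ∀ k < M, ∑ j : Fin J, (f ^ e * hasseDeriv k (f ^ M * r j) +
        C a * hasseDeriv k (f ^ (M + e) * s j)) * X ^ (j : ℕ) = 0 := by
  let V := (Fin J → degreeLT K L) × (Fin J → degreeLT K L)
  let Ψ : (k : ℕ) → V →ₗ[K] K[X] := fun k =>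
    ∑ j : Fin J, (LinearMap.mulRight K ((X : K[X]) ^ (j : ℕ))) ∘ₗ
      (((LinearMap.mulLeft K (f ^ e)) ∘ₗ (hasseDeriv k) ∘ₗ (LinearMap.mulLeft K (f ^ M)) ∘ₗ
        (degreeLT K L).subtype ∘ₗ (LinearMap.proj j) ∘ₗ (LinearMap.fst K _ _)) +
       ((LinearMap.mulLeft K (C a)) ∘ₗ (hasseDeriv k) ∘ₗ (LinearMap.mulLeft K (f ^ (M + e))) ∘ₗ
        (degreeLT K L).subtype ∘ₗ (LinearMap.proj j) ∘ₗ (LinearMap.snd K _ _)))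
  have hΨ : ∀ k (v : V), Ψ k v = ∑ j : Fin J, (f ^ e * hasseDeriv k (f ^ M * (v.1 j : K[X])) +
        C a * hasseDeriv k (f ^ (M + e) * (v.2 j : K[X]))) * X ^ (j : ℕ) := by
    intro k v
    simp [Ψ]
    rfl
  let T : ℕ → ℕ := fun k => L + J + k * f.natDegree
  let N : ℕ → Submodule K K[X] := fun k =>
    (degreeLT K (T k)).map (LinearMap.mulLeft K (f ^ (M + e - k)))
  have hmem : ∀ k < M, ∀ v, Ψ k v ∈ N k := by
    intro k hk v
    rw [hΨ]
    refine Submodule.sum_mem _ fun j _ => ?_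
    have hLd : ∀ u : degreeLT K L, (u : K[X]).degree < L := fun u => mem_degreeLT.mp u.2
    have main : ∀ w : K[X], f ^ (M + e - k) ∣ w →
        w.degree < ((M + e) * f.natDegree + L : ℕ) → w * X ^ (j : ℕ) ∈ N k := by
      rintro w ⟨u, rfl⟩ hw
      refine ⟨u * X ^ (j : ℕ), ?_, by simp [mul_assoc]⟩
      rw [SetLike.mem_coe, mem_degreeLT]
      rcases eq_or_ne u 0 with rfl | hu
      · simp
      rw [← natDegree_lt_iff_degree_lt (mul_ne_zero (pow_ne_zero _ hf) hu),
        natDegree_mul (pow_ne_zero _ hf) hu, natDegree_pow] at hw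
      rw [← natDegree_lt_iff_degree_lt (mul_ne_zero hu (by simp)),
        natDegree_mul hu (by simp), natDegree_X_pow]
      have h1 : (M + e) * f.natDegree = (M + e - k) * f.natDegree + k * f.natDegree := by
        rw [← add_mul]; congr 1; omega
      have := j.2
      simp only [T]
      omega
    have hdegm : ∀ (l : ℕ) (u : degreeLT K L), (f ^ l * (u : K[X])).degree <
        (l * f.natDegree + L : ℕ) := by
      intro l u
      rcases eq_or_ne (u : K[X]) 0 with h | hu
      · rw [h, mul_zero, degree_zero]; exact WithBot.bot_lt_coe _
      have hul := hLd u
      rw [← natDegree_lt_iff_degree_lt hu] at hul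
      rw [← natDegree_lt_iff_degree_lt (mul_ne_zero (pow_ne_zero _ hf) hu),
        natDegree_mul (pow_ne_zero _ hf) hu, natDegree_pow]
      omega
    have hhd : ∀ (w : K[X]) (n : ℕ), w.degree < n → (hasseDeriv k w).degree < n := by
      intro w n hw
      rcases eq_or_ne (hasseDeriv k w) 0 with h | h
      · rw [h, degree_zero]; exact WithBot.bot_lt_coe _
      have hw0 : w ≠ 0 := by rintro rfl; simp at h
      rw [← natDegree_lt_iff_degree_lt h]
      rw [← natDegree_lt_iff_degree_lt hw0] at hw
      exact ((natDegree_hasseDeriv_le w k).trans (Nat.sub_le _ _)).trans_lt hw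
    refine main _ (dvd_add ?_ ?_) ((degree_add_le _ _).trans_lt (max_lt ?_ ?_))
    · have : f ^ (M + e - k) = f ^ e * f ^ (M - k) := by rw [← pow_add]; congr 1; omega
      rw [this]
      exact mul_dvd_mul_left _ (pow_dvd_hasseDeriv_pow_mul _ _ _ _)
    · exact Dvd.dvd.mul_left (pow_dvd_hasseDeriv_pow_mul _ _ _ _) _
    · have h1 := hhd _ _ (hdegm M (v.1 j))
      rcases eq_or_ne (hasseDeriv k (f ^ M * (v.1 j : K[X]))) 0 with h | h
      · rw [h, mul_zero, degree_zero]; exact WithBot.bot_lt_coe _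
      rw [← natDegree_lt_iff_degree_lt h] at h1
      rw [← natDegree_lt_iff_degree_lt (mul_ne_zero (pow_ne_zero _ hf) h),
        natDegree_mul (pow_ne_zero _ hf) h, natDegree_pow, add_mul]
      omega
    · refine lt_of_le_of_lt ?_ (hhd _ _ (hdegm (M + e) (v.2 j)))
      rw [← smul_eq_C_mul]
      exact degree_smul_le _ _
  have hfd : ∀ k, FiniteDimensional K (degreeLT K (T k)) := fun k =>
    (degreeLTEquiv K (T k)).symm.finiteDimensional
  have hfdN : ∀ k, FiniteDimensional K (N k) := fun k => inferInstance
  have hfdL : FiniteDimensional K (degreeLT K L) := (degreeLTEquiv K L).symm.finiteDimensional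
  let Φ : V →ₗ[K] ((k : Fin M) → N k) :=
    LinearMap.pi fun k => (Ψ k).codRestrict (N k) (hmem k k.2)
  have hlt : Module.finrank K ((k : Fin M) → N k) < Module.finrank K V := by
    rw [Module.finrank_pi_fintype, Module.finrank_prod, Module.finrank_pi_fintype]
    simp only [finrank_degreeLT, Finset.sum_const, Finset.card_univ, Fintype.card_fin, smul_eq_mul]
    have h1 : ∑ k : Fin M, Module.finrank K (N k) ≤ ∑ k : Fin M, T k := by
      refine Finset.sum_le_sum fun k _ => ?_
      refine (Submodule.finrank_map_le _ _).trans ?_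
      rw [finrank_degreeLT]
    have h2 : ∑ k : Fin M, T k = M * (L + J) + (∑ i ∈ Finset.range M, i) * f.natDegree := by
      rw [Fin.sum_univ_eq_sum_range T M]
      simp only [T, Finset.sum_add_distrib, Finset.sum_mul, Finset.sum_const, Finset.card_range,
        smul_eq_mul]
      ring
    have h3 := Finset.sum_range_id_mul_two M
    have h4 : 2 * ∑ k : Fin M, T k = 2 * M * (L + J) + f.natDegree * (M * (M - 1)) := by
      rw [h2, ← h3]; ring
    have h5 : 4 * J * L = 4 * (J * L) := by ring
    omega
  have hker : LinearMap.ker Φ ≠ ⊥ := LinearMap.ker_ne_bot_of_finrank_lt hlt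
  obtain ⟨v, hv, hv0⟩ := Submodule.exists_mem_ne_zero_of_ne_bot hker
  refine ⟨fun j => v.1 j, fun j => v.2 j, fun j => (v.1 j).2, fun j => (v.2 j).2, ?_, ?_⟩
  · by_contra hcon
    push Not at hcon
    apply hv0
    ext j : 2
    · exact Subtype.ext (hcon j).1
    · exact Subtype.ext (hcon j).2
  · intro k hk
    rw [← hΨ]
    have := congrFun (LinearMap.mem_ker.mp hv) ⟨k, hk⟩
    exact congrArg Subtype.val this

/-- Stepanov's upper bound for the number of points where `f ^ ((q - 1) / 2)` takes a prescribed
nonzero value. -/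
theorem stepanov_card_le {K : Type*} [Field K] [Fintype K] (f : K[X]) (hodd : Odd f.natDegree)
    (a : K) (ha : a ≠ 0) (L e M J : ℕ)
    (hL : 2 * L + f.natDegree = Fintype.card K) (he : 2 * e + 1 = Fintype.card K)
    (hM : M ≤ Fintype.card K)
    (hdim : 2 * M * (L + J) + f.natDegree * (M * (M - 1)) < 4 * J * L) (S : Finset K)
    (hS : ∀ α ∈ S, f.eval α ^ e = a) :
    M * S.card ≤ M * f.natDegree + (e * f.natDegree + L + J * Fintype.card K) := by
  have hf : f ≠ 0 := by rintro rfl; simp at hodd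
  set q := Fintype.card K with hq
  obtain ⟨r, s, hr, hs, hne, h0⟩ := exists_stepanov_coeffs f hf a L e M J hdim
  have hR := sum_blocks_ne_zero hL hodd e he r s hr hs hne
  set R := ∑ j : Fin J, (r j + f ^ e * s j) * X ^ ((j : ℕ) * q) with hRdef
  have hg : f ^ M * R ≠ 0 := mul_ne_zero (pow_ne_zero _ hf) hR
  have hle := mul_card_le_natDegree (f ^ M * R) hg S M ?_
  · refine hle.trans ?_
    rw [natDegree_mul (pow_ne_zero _ hf) hR, natDegree_pow]
    refine Nat.add_le_add_left ?_ _
    refine natDegree_sum_le_of_forall_le _ _ fun j _ => ?_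
    have hnd : ∀ u : K[X], u ∈ degreeLT K L → u.natDegree ≤ L := by
      intro u hu
      rw [mem_degreeLT] at hu
      exact natDegree_le_of_degree_le hu.le
    refine natDegree_mul_le.trans ?_
    rw [natDegree_X_pow]
    have h1 : (r j + f ^ e * s j).natDegree ≤ e * f.natDegree + L := by
      refine natDegree_add_le_of_degree_le ((hnd _ (hr j)).trans (by omega)) ?_
      refine natDegree_mul_le.trans ?_
      rw [natDegree_pow]
      exact Nat.add_le_add_left (hnd _ (hs j)) _
    have h2 : (j : ℕ) * q ≤ J * q := Nat.mul_le_mul_right _ j.2.le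
    omega
  · intro α hα k hk
    have hfα := hS α hα
    have h1 : f ^ M * R = ∑ j : Fin J, (f ^ M * r j + f ^ (M + e) * s j) * X ^ ((j : ℕ) * q) := by
      rw [hRdef, Finset.mul_sum]
      refine Finset.sum_congr rfl fun j _ => ?_
      rw [pow_add]; ring
    rw [h1, map_sum, eval_finsetSum]
    have h2 := congrArg (eval α) (h0 k hk)
    simp only [eval_finsetSum, eval_mul, eval_add, eval_pow, eval_X, eval_zero, eval_C,
      hfα] at h2
    have h3 : a * ∑ j : Fin J, eval α (hasseDeriv k ((f ^ M * r j + f ^ (M + e) * s j) *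
        X ^ ((j : ℕ) * q))) = 0 := by
      rw [← h2, Finset.mul_sum]
      refine Finset.sum_congr rfl fun j _ => ?_
      rw [eval_hasseDeriv_mul_X_pow _ _ _ _ (by omega), map_add, eval_add]
      ring
    exact (mul_eq_zero.mp h3).resolve_left ha

theorem card_pow_eq_le {K : Type*} [Field K] [Fintype K] (f : K[X]) (hodd : Odd f.natDegree)
    (hq : Odd (Fintype.card K)) (hd : 3 * (f.natDegree : ℝ) ≤ √(Fintype.card K : ℝ))
    (a : K) (ha : a ≠ 0) (S : Finset K)
    (hS : ∀ α ∈ S, f.eval α ^ (Fintype.card K / 2) = a) :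
    (S.card : ℝ) ≤ Fintype.card K / 2 + 30 * f.natDegree * √(Fintype.card K : ℝ) := by
  set q := Fintype.card K with hqdef
  set d := f.natDegree with hddef
  have hd1 : 1 ≤ d := hodd.pos
  have hd1' : (1 : ℝ) ≤ d := by exact_mod_cast hd1
  set x := √(q : ℝ) with hx
  have hxq : x ^ 2 = q := Real.sq_sqrt (Nat.cast_nonneg q)
  have hx3 : 3 ≤ x := by linarith
  have hdq : d < q := by
    have : (d : ℝ) < q := by nlinarith
    exact_mod_cast this
  obtain ⟨L, hL⟩ : ∃ L, 2 * L + d = q := by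
    obtain ⟨u, hu⟩ := hodd; obtain ⟨v, hv⟩ := hq
    exact ⟨v - u, by omega⟩
  set t := ⌊x / 2⌋₊ with ht
  have ht1 : (t : ℝ) ≤ x / 2 := Nat.floor_le (by linarith)
  have ht2 : x / 2 < t + 1 := Nat.lt_floor_add_one _
  have ht0 : 1 ≤ t := by
    rw [ht]; exact Nat.le_floor (by push_cast; linarith)
  have ht0' : (1 : ℝ) ≤ t := by exact_mod_cast ht0
  clear_value t
  have hLr : 2 * (L : ℝ) + d = q := by exact_mod_cast hL
  have htL : t ^ 2 + t < L := by
    have : (t : ℝ) ^ 2 + t < L := by nlinarith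
    exact_mod_cast this
  have h1 := stepanov_card_le f hodd a ha L (q / 2) (2 * t) (t + 2 * d) hL
    (by obtain ⟨v, hv⟩ := hq; omega) (by
      have : (2 * t : ℝ) ≤ q := by nlinarith
      exact_mod_cast this) (by
      rw [← hddef]
      clear ht
      obtain ⟨t', rfl⟩ : ∃ t', t = t' + 1 := ⟨t - 1, by omega⟩
      have : 2 * (t' + 1) - 1 = 2 * t' + 1 := by omega
      rw [this]
      nlinarith [Nat.mul_le_mul_left (8 * d) htL.le, Nat.mul_le_mul hd1 (le_refl ((t' + 1) ^ 2))])
    S hS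
  rw [← hddef, ← hqdef] at h1
  have he2 : ((q / 2 : ℕ) : ℝ) ≤ q / 2 := Nat.cast_div_le
  have h2 : (2 * t : ℝ) * S.card ≤ 2 * t * d + (((q / 2 : ℕ) : ℝ) * d + L + (t + 2 * d) * q) := by
    exact_mod_cast h1
  have h3 : (2 * t : ℝ) * S.card ≤ 2 * t * (q / 2 + d) + 3 * d * q := by nlinarith
  have h4 : (q : ℝ) ≤ 6 * t * x := by nlinarith
  have h5 : (2 * t : ℝ) * S.card ≤ 2 * t * (q / 2 + d + 9 * d * x) := by nlinarith
  have h6 : (S.card : ℝ) ≤ q / 2 + d + 9 * d * x := le_of_mul_le_mul_left h5 (by linarith)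
  nlinarith

/-- Weil's bound, with a worse constant, for quadratic character sums of odd degree. -/
theorem abs_sum_quadraticChar_le {K : Type*} [Field K] [Fintype K] [DecidableEq K] (f : K[X])
    (hodd : Odd f.natDegree) (hq : Odd (Fintype.card K)) :
    |∑ x : K, (quadraticChar K (f.eval x) : ℝ)| ≤ 100 * f.natDegree * √(Fintype.card K : ℝ) := by
  set q := Fintype.card K with hqdef
  set y := √(q : ℝ) with hy
  have hyq : y ^ 2 = q := Real.sq_sqrt (Nat.cast_nonneg q)
  have hy0 : 0 ≤ y := Real.sqrt_nonneg _
  have hf : f ≠ 0 := by rintro rfl; simp at hodd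
  have hd1 : (1 : ℝ) ≤ f.natDegree := by exact_mod_cast hodd.pos
  have hchar : ringChar K ≠ 2 := by
    intro h
    have := FiniteField.even_card_iff_char_two.mp h
    rw [← hqdef] at this
    obtain ⟨v, hv⟩ := hq; omega
  rcases le_or_gt (3 * (f.natDegree : ℝ)) y with hd | hd
  · let S : ℤ → Finset K := fun i => Finset.univ.filter fun x => quadraticChar K (f.eval x) = i
    have hmem : ∀ i x, x ∈ S i ↔ quadraticChar K (f.eval x) = i := by simp [S]
    have hneg : (-1 : K) ≠ 1 := Ring.neg_one_ne_one_of_char_ne_two hchar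
    have b1 := card_pow_eq_le f hodd hq hd 1 one_ne_zero (S 1) (by
      intro α hα
      rw [← hqdef, ← quadraticChar_eq_pow_of_char_ne_two' hchar, (hmem _ _).mp hα]; simp)
    have b2 := card_pow_eq_le f hodd hq hd (-1) (by simp) (S (-1)) (by
      intro α hα
      rw [← hqdef, ← quadraticChar_eq_pow_of_char_ne_two' hchar, (hmem _ _).mp hα]; simp)
    have b0 : (S 0).card ≤ f.natDegree := by
      refine (Finset.card_le_card ?_).trans (f.roots.toFinset_card_le.trans (card_roots' f))
      intro x hx
      rw [hmem, quadraticChar_eq_zero_iff] at hx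
      simp [hf, hx]
    have hpt : ∀ x : K, (quadraticChar K (f.eval x) : ℝ) =
        (if x ∈ S 1 then 1 else 0) - (if x ∈ S (-1) then 1 else 0) ∧
        (1 : ℝ) = (if x ∈ S 1 then 1 else 0) + (if x ∈ S (-1) then 1 else 0) +
          (if x ∈ S 0 then 1 else 0) := by
      intro x
      simp only [hmem]
      by_cases h0 : f.eval x = 0
      · simp [h0]
      · rcases quadraticChar_dichotomy h0 with h | h <;> simp [h]
    have hsum1 : ∑ x : K, (quadraticChar K (f.eval x) : ℝ) = (S 1).card - (S (-1)).card := by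
      rw [Finset.sum_congr rfl fun x _ => (hpt x).1, Finset.sum_sub_distrib]
      simp
    have hsum2 : (q : ℝ) = (S 1).card + (S (-1)).card + (S 0).card := by
      have : ∑ x : K, (1 : ℝ) = q := by simp [hqdef]
      rw [← this, Finset.sum_congr rfl fun x _ => (hpt x).2, Finset.sum_add_distrib,
        Finset.sum_add_distrib]
      simp
    have b0' : ((S 0).card : ℝ) ≤ f.natDegree := by exact_mod_cast b0
    rw [hsum1, abs_le]
    rw [← hqdef, ← hy] at b1 b2
    constructor <;> nlinarith
  · have h1 : |∑ x : K, (quadraticChar K (f.eval x) : ℝ)| ≤ ∑ x : K, (1 : ℝ) := by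
      refine (Finset.abs_sum_le_sum_abs _ _).trans (Finset.sum_le_sum fun x _ => ?_)
      by_cases h0 : f.eval x = 0
      · simp [h0]
      · rcases quadraticChar_dichotomy h0 with h | h <;> simp [h]
    have h2 : ∑ x : K, (1 : ℝ) = q := by simp [hqdef]
    rw [h2] at h1
    refine h1.trans ?_
    nlinarith

section ResultantMonic

variable {K : Type*} [Field K]

theorem algebraMap_resultant_of_splits {E : Type*} [Field E] [Algebra K E] {f : K[X]}
    (hf : f.Monic) (hs : (f.map (algebraMap K E)).Splits) (g : K[X]) (n : ℕ)
    (hn : g.natDegree ≤ n) :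
    algebraMap K E (resultant f g f.natDegree n) =
      ((f.map (algebraMap K E)).roots.map fun α => aeval α g).prod := by
  rw [← resultant_map_map]
  have h := resultant_eq_prod_eval (f.map (algebraMap K E)) (g.map (algebraMap K E)) n
    (natDegree_map_le.trans hn) hs
  rw [natDegree_map] at h
  rw [h, (hf.map _).leadingCoeff, one_pow, one_mul]
  simp only [eval_map_algebraMap]

theorem algebraMap_resultant {f : K[X]} (hf : f.Monic) (g : K[X]) :
    algebraMap K (AlgebraicClosure K) (resultant f g) =
      ((f.map (algebraMap K (AlgebraicClosure K))).roots.map fun α => aeval α g).prod :=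
  algebraMap_resultant_of_splits hf (IsAlgClosed.splits _) g _ le_rfl

theorem resultant_mul_right_of_monic {f : K[X]} (hf : f.Monic) (g h : K[X]) :
    resultant f (g * h) = resultant f g * resultant f h := by
  apply (algebraMap K (AlgebraicClosure K)).injective
  simp only [map_mul, algebraMap_resultant hf, Multiset.prod_map_mul]

theorem resultant_mul_left_of_monic {f g : K[X]} (hf : f.Monic) (hg : g.Monic) (h : K[X]) :
    resultant (f * g) h = resultant f h * resultant g h := by
  rw [hf.natDegree_mul hg, resultant_mul_left _ _ _ _ le_rfl]

theorem resultant_congr_of_monic {f : K[X]} (hf : f.Monic) {g h : K[X]} (hgh : f ∣ g - h) :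
    resultant f g = resultant f h := by
  apply (algebraMap K (AlgebraicClosure K)).injective
  simp only [algebraMap_resultant hf]
  congr 1
  refine Multiset.map_congr rfl fun α hα => ?_
  obtain ⟨k, hk⟩ := hgh
  have h0 : aeval α f = 0 := by
    rw [mem_roots (hf.map _).ne_zero, IsRoot, eval_map_algebraMap] at hα; exact hα
  have := congrArg (aeval α) hk
  rw [map_sub, map_mul, h0, zero_mul, sub_eq_zero] at this
  exact this

theorem resultant_ne_zero_iff_of_monic {f : K[X]} (hf : f.Monic) (g : K[X]) :
    resultant f g ≠ 0 ↔ IsCoprime f g := by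
  rw [← isUnit_resultant_iff_isCoprime hf, isUnit_iff_ne_zero]

end ResultantMonic

section Mu

variable {K : Type*} [Field K]

/-- The discriminant of a monic polynomial, as a signed resultant with the derivative. -/
noncomputable def monicDiscr (f : K[X]) : K :=
  (-1) ^ (f.natDegree * (f.natDegree - 1) / 2) * resultant f (derivative f)

theorem monicDiscr_mul {f g : K[X]} (hf : f.Monic) (hg : g.Monic) :
    monicDiscr (f * g) = monicDiscr f * monicDiscr g * resultant f g ^ 2 := by
  have h1 : resultant f (derivative (f * g)) = resultant f (derivative f) * resultant f g := by
    rw [← resultant_mul_right_of_monic hf]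
    exact resultant_congr_of_monic hf ⟨derivative g, by rw [derivative_mul]; ring⟩
  have h2 : resultant g (derivative (f * g)) = resultant g (derivative g) * resultant g f := by
    rw [← resultant_mul_right_of_monic hg]
    exact resultant_congr_of_monic hg ⟨derivative f, by rw [derivative_mul]; ring⟩
  have h3 := resultant_comm g f g.natDegree f.natDegree
  have h4 : (f.natDegree + g.natDegree) * (f.natDegree + g.natDegree - 1) / 2 =
      f.natDegree * (f.natDegree - 1) / 2 + g.natDegree * (g.natDegree - 1) / 2 +
        g.natDegree * f.natDegree := by
    simp only [← Nat.choose_two_right]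
    generalize f.natDegree = a
    induction g.natDegree with
    | zero => simp
    | succ b ih =>
      rw [← add_assoc, Nat.choose_succ_succ' (a + b) 1, Nat.choose_succ_succ' b 1, ih]
      simp only [Nat.choose_one_right]
      ring
  rw [monicDiscr, resultant_mul_left_of_monic hf hg, h1, h2, h3, hf.natDegree_mul hg, h4,
    monicDiscr, monicDiscr, pow_add, pow_add]
  have h5 : ((-1 : K) ^ (g.natDegree * f.natDegree)) * (-1) ^ (g.natDegree * f.natDegree) = 1 := by
    rw [← mul_pow]; simp
  linear_combination ((-1 : K) ^ (f.natDegree * (f.natDegree - 1) / 2) *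
    (-1) ^ (g.natDegree * (g.natDegree - 1) / 2) * resultant f (derivative f) *
    resultant g (derivative g) * resultant f g ^ 2) * h5

theorem monicDiscr_eq_zero_of_sq_dvd {f p : K[X]} (hf : f.Monic) (hp : ¬IsUnit p)
    (h : p ^ 2 ∣ f) : monicDiscr f = 0 := by
  have : resultant f (derivative f) = 0 := by
    by_contra hne
    have hc := (resultant_ne_zero_iff_of_monic hf _).mp hne
    obtain ⟨k, rfl⟩ := h
    refine hp (hc.isUnit_of_dvd' ⟨p * k, by ring⟩ ⟨2 * derivative p * k + p * derivative k, ?_⟩)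
    rw [derivative_mul, derivative_pow]
    simp only [Nat.cast_ofNat, map_ofNat, Nat.add_one_sub_one, pow_one]
    ring
  rw [monicDiscr, this, mul_zero]

variable [Fintype K] [DecidableEq K]

/-- The Möbius function on monic polynomials, defined through Pellet's formula. -/
noncomputable def polyMu (f : K[X]) : ℤ := (-1) ^ f.natDegree * quadraticChar K (monicDiscr f)

theorem polyMu_one : polyMu (1 : K[X]) = 1 := by
  simp [polyMu, monicDiscr]

theorem abs_polyMu_le_one (f : K[X]) : |polyMu f| ≤ 1 := by
  rw [polyMu, abs_mul, abs_neg_one_pow, one_mul]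
  by_cases h : monicDiscr f = 0
  · simp [h]
  · rcases quadraticChar_dichotomy h with h | h <;> simp [h]

theorem polyMu_mul {f g : K[X]} (hf : f.Monic) (hg : g.Monic) (h : IsCoprime f g) :
    polyMu (f * g) = polyMu f * polyMu g := by
  rw [polyMu, monicDiscr_mul hf hg, map_mul, map_mul, map_pow,
    quadraticChar_sq_one ((resultant_ne_zero_iff_of_monic hf g).mpr h), hf.natDegree_mul hg,
    pow_add, polyMu, polyMu]
  ring

theorem polyMu_eq_zero_of_sq_dvd {f p : K[X]} (hf : f.Monic) (hp : ¬IsUnit p)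
    (h : p ^ 2 ∣ f) : polyMu f = 0 := by
  rw [polyMu, monicDiscr_eq_zero_of_sq_dvd hf hp h]; simp

end Mu

theorem prod_prod_erase_sub_eq {R : Type*} [CommRing R] {n : ℕ} (v : Fin n → R) :
    ∏ i, ∏ j ∈ Finset.univ.erase i, (v i - v j) =
      (-1) ^ (n * (n - 1) / 2) * (Matrix.vandermonde v).det ^ 2 := by
  have h1 := Finset.prod_prod_Ioi_mul_eq_prod_prod_off_diag (fun i j : Fin n => v j - v i)
  have h2 : ∏ i : Fin n, ∏ j ∈ Finset.Ioi i, (-1 : R) = (-1) ^ (n * (n - 1) / 2) := by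
    simp only [Finset.prod_const, Fin.card_Ioi, Finset.prod_pow_eq_pow_sum]
    rw [Fin.sum_univ_eq_sum_range (fun i => n - 1 - i) n, Finset.sum_range_reflect (fun i => i) n,
      Finset.sum_range_id]
  rw [Matrix.det_vandermonde, ← h2, ← Finset.prod_pow, ← Finset.prod_mul_distrib]
  simp only [← Finset.prod_pow, ← Finset.prod_mul_distrib]
  trans ∏ i : Fin n, ∏ j ∈ {i}ᶜ, (v i - v j)
  · refine Finset.prod_congr rfl fun i _ => ?_
    rw [Finset.compl_eq_univ_sdiff, Finset.sdiff_singleton_eq_erase]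
  rw [← h1]
  refine Finset.prod_congr rfl fun i _ => Finset.prod_congr rfl fun j _ => ?_
  ring

section Pellet

variable {K : Type*} [Field K] [Fintype K]

/-- The roots of an irreducible polynomial over a finite field are the Frobenius conjugates. -/
theorem roots_adjoinRoot_eq {P : K[X]} [Fact (Irreducible P)] (hP : P.Monic) :
    Function.Injective
      (fun i : Fin P.natDegree => AdjoinRoot.root P ^ Fintype.card K ^ (i : ℕ)) ∧
    (P.map (algebraMap K (AdjoinRoot P))).roots =
      (Finset.univ : Finset (Fin P.natDegree)).val.map
        (fun i : Fin P.natDegree => AdjoinRoot.root P ^ Fintype.card K ^ (i : ℕ)) ∧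
    AdjoinRoot.root P ^ Fintype.card K ^ P.natDegree = AdjoinRoot.root P := by
  set q := Fintype.card K
  have hfin : Module.finrank K (AdjoinRoot P) = P.natDegree :=
    (AdjoinRoot.powerBasis hP.ne_zero).finrank
  have : Module.Finite K (AdjoinRoot P) := (AdjoinRoot.powerBasis hP.ne_zero).finite
  have : Finite (AdjoinRoot P) := Module.finite_of_finite K
  let φ := FiniteField.frobeniusAlgHom K (AdjoinRoot P)
  have hφ : ∀ (i : ℕ) x, (φ ^ i) x = x ^ q ^ i := by
    intro i
    induction i with
    | zero => simp
    | succ i ih => intro x; rw [pow_succ, AlgHom.mul_apply, ih]; simp [φ, pow_succ', pow_mul, q]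
  have hord : orderOf φ = P.natDegree := by
    rw [FiniteField.orderOf_frobeniusAlgHom, hfin]
  have hinj : Function.Injective
      (fun i : Fin P.natDegree => AdjoinRoot.root P ^ q ^ (i : ℕ)) := by
    intro i j hij
    have hij' : φ ^ (i : ℕ) = φ ^ (j : ℕ) := by
      apply AdjoinRoot.algHom_ext
      rw [hφ, hφ]; exact hij
    exact Fin.ext (pow_injOn_Iio_orderOf (by simp [hord]) (by simp [hord]) hij')
  refine ⟨hinj, ?_, ?_⟩
  · symm
    apply Multiset.eq_of_le_of_card_le
    · rw [Multiset.le_iff_subset]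
      · intro x hx
        obtain ⟨i, -, rfl⟩ := Multiset.mem_map.mp hx
        rw [mem_roots (hP.map _).ne_zero, IsRoot, eval_map_algebraMap, ← hφ, aeval_algHom_apply]
        simp
      · exact (Multiset.nodup_map_iff_of_injective hinj).mpr Finset.univ.nodup
    · refine (card_roots' _).trans ?_
      simp
  · rw [← hφ, ← hord, pow_orderOf_eq_one]; rfl

theorem monicDiscr_pow_card_div_two {P : K[X]} (hP : P.Monic) (hirr : Irreducible P)
    (hq : Odd (Fintype.card K)) :
    monicDiscr P ^ (Fintype.card K / 2) = (-1) ^ (P.natDegree - 1) := by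
  have : Fact (Irreducible P) := ⟨hirr⟩
  obtain ⟨hinj, hroots, hper⟩ := roots_adjoinRoot_eq hP
  set q := Fintype.card K with hqd
  let L := AdjoinRoot P
  set v : Fin P.natDegree → L := fun i => AdjoinRoot.root P ^ q ^ (i : ℕ) with hv
  have hsp : (P.map (algebraMap K L)).Splits := by
    rw [splits_iff_card_roots, hroots]; simp
  have hprod : P.map (algebraMap K L) = Lagrange.nodal Finset.univ v := by
    rw [hsp.eq_prod_roots_of_monic (hP.map _), hroots, Multiset.map_map]
    rfl
  have hres : algebraMap K L (monicDiscr P) = (Matrix.vandermonde v).det ^ 2 := by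
    rw [monicDiscr, map_mul, algebraMap_resultant_of_splits hP hsp _ _ le_rfl, hroots,
      Multiset.map_map]
    have h1 : ∀ i, aeval (v i) (derivative P) = ∏ j ∈ Finset.univ.erase i, (v i - v j) := by
      intro i
      rw [← eval_map_algebraMap, ← derivative_map, hprod,
        Lagrange.eval_nodal_derivative_eval_node_eq (Finset.mem_univ i), Lagrange.eval_nodal]
    change _ * ∏ i, aeval (v i) (derivative P) = _
    rw [Finset.prod_congr rfl fun i _ => h1 i, prod_prod_erase_sub_eq, ← mul_assoc]
    rw [map_pow, map_neg, map_one, ← mul_pow]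
    norm_num
  set δ := (Matrix.vandermonde v).det with hδ
  have hδ0 : δ ≠ 0 := Matrix.det_vandermonde_ne_zero_iff.mpr hinj
  have hrot : ∀ i, v (finRotate _ i) = v i ^ q := by
    intro i
    obtain ⟨m, hm⟩ : ∃ m, P.natDegree = m + 1 := ⟨P.natDegree - 1, by
      have := hirr.natDegree_pos; omega⟩
    have key : ∀ (N : ℕ) (hN : N = m + 1) (j : Fin N),
        AdjoinRoot.root P ^ q ^ N = AdjoinRoot.root P →
        AdjoinRoot.root P ^ q ^ ((finRotate N j : Fin N) : ℕ) =
          (AdjoinRoot.root P ^ q ^ (j : ℕ)) ^ q := by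
      rintro N rfl j hN
      rw [← pow_mul, ← pow_succ]
      rcases eq_or_ne j (Fin.last m) with rfl | hj
      · rw [finRotate_last, Fin.val_last, hN]; simp
      · rw [coe_finRotate_of_ne_last hj]
    exact key _ hm i hper
  have hδq : δ ^ q = (-1) ^ (P.natDegree - 1) * δ := by
    have h1 : δ ^ q = FiniteField.frobeniusAlgHom K L δ := by simp [hqd]
    rw [h1, hδ, AlgHom.map_det]
    have h2 : (FiniteField.frobeniusAlgHom K L).mapMatrix (Matrix.vandermonde v) =
        (Matrix.vandermonde v).submatrix (finRotate _) id := by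
      ext i j
      simp only [AlgHom.mapMatrix_apply, Matrix.map_apply, Matrix.vandermonde_apply,
        Matrix.submatrix_apply, id, hrot, FiniteField.coe_frobeniusAlgHom, ← hqd]
      exact pow_right_comm _ _ _
    rw [h2, Matrix.det_permute, sign_finRotate]
    simp
  apply (algebraMap K L).injective
  rw [map_pow, hres, map_pow, map_neg, map_one, ← pow_mul]
  apply mul_right_cancel₀ hδ0
  rw [← pow_succ, ← hδq]
  congr 1
  obtain ⟨u, hu⟩ := hq
  omega

theorem ringChar_ne_two_of_odd_card (hq : Odd (Fintype.card K)) : ringChar K ≠ 2 := by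
  intro h
  have := FiniteField.even_card_iff_char_two.mp h
  obtain ⟨v, hv⟩ := hq
  omega

variable [DecidableEq K]

theorem polyMu_irreducible {P : K[X]} (hP : P.Monic) (hirr : Irreducible P)
    (hq : Odd (Fintype.card K)) : polyMu P = -1 := by
  have hchar := ringChar_ne_two_of_odd_card hq
  have h1 := monicDiscr_pow_card_div_two hP hirr hq
  have hD : monicDiscr P ≠ 0 := by
    intro h
    rw [h, zero_pow] at h1
    · exact (pow_ne_zero (P.natDegree - 1) (neg_ne_zero.mpr (one_ne_zero (α := K)))) h1.symm
    · have : 1 < Fintype.card K := Fintype.one_lt_card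
      omega
  have h2 := quadraticChar_eq_pow_of_char_ne_two hchar hD
  have hneg : (-1 : K) ≠ 1 := Ring.neg_one_ne_one_of_char_ne_two hchar
  have hpos := hirr.natDegree_pos
  obtain ⟨m, hm⟩ : ∃ m, P.natDegree = m + 1 := ⟨P.natDegree - 1, by omega⟩
  rw [polyMu, h2, h1, hm]
  rcases Nat.even_or_odd m with h | h
  · simp [h.neg_one_pow, pow_succ]
  · simp [h.neg_one_pow, hneg, pow_succ]

theorem polyMu_irreducible_mul {P e : K[X]} (hP : P.Monic) (hirr : Irreducible P)
    (hq : Odd (Fintype.card K)) (he : e.Monic) (h : ¬P ∣ e) : polyMu (P * e) = -polyMu e := by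
  rw [polyMu_mul hP he ((hirr.coprime_iff_not_dvd).mpr h), polyMu_irreducible hP hirr hq,
    neg_one_mul]

end Pellet

theorem exists_forall_dvd_and_dvd_sub_iff {K : Type*} [Field K] {u v : K[X]}
    (h : IsCoprime u v) (F : K[X]) :
    ∃ r, ∀ g, (u ∣ g ∧ v ∣ F - g) ↔ u * v ∣ g - r := by
  obtain ⟨a, b, hab⟩ := h
  refine ⟨F * (a * u), fun g => ?_⟩
  have hu : u ∣ g ↔ u ∣ g - F * (a * u) :=
    (dvd_sub_left ⟨F * a, by ring⟩).symm
  have hv : v ∣ F - g ↔ v ∣ g - F * (a * u) := by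
    rw [dvd_sub_comm]
    have : g - F * (a * u) = (g - F) + v * (F * b) := by linear_combination (-F) * hab
    rw [this]
    exact (dvd_add_left ⟨_, rfl⟩).symm
  rw [hu, hv]
  exact ⟨fun h' => IsCoprime.mul_dvd ⟨a, b, hab⟩ h'.1 h'.2,
    fun h' => ⟨(dvd_mul_right _ _).trans h', (dvd_mul_left _ _).trans h'⟩⟩

section Monics

variable (K : Type*) [Field K] [Fintype K]

/-- The finite set of monic polynomials of degree `n` over a finite field. -/
noncomputable def monics (n : ℕ) : Finset K[X] :=
  (Finset.univ : Finset (Fin n → K)).map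
    ⟨fun v => X ^ n + ((degreeLTEquiv K n).symm v : K[X]), fun v w h => by simpa using h⟩

theorem card_monics (n : ℕ) : (monics K n).card = Fintype.card K ^ n := by
  simp [monics]

variable {K}

theorem mem_monics {n : ℕ} {f : K[X]} : f ∈ monics K n ↔ f.Monic ∧ f.natDegree = n := by
  have hmem : f ∈ monics K n ↔ ∃ v : Fin n → K,
      X ^ n + ((degreeLTEquiv K n).symm v : K[X]) = f := by
    simp only [monics, Finset.mem_map, Finset.mem_univ, true_and]
    rfl
  rw [hmem]
  constructor
  · rintro ⟨v, rfl⟩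
    have h := mem_degreeLT.mp ((degreeLTEquiv K n).symm v).2
    exact ⟨monic_X_pow_add h, by
      rw [natDegree_add_eq_left_of_degree_lt (by rwa [degree_X_pow]), natDegree_X_pow]⟩
  · rintro ⟨hf, rfl⟩
    have h : f - X ^ f.natDegree ∈ degreeLT K f.natDegree := by
      rw [mem_degreeLT, ← degree_eq_natDegree hf.ne_zero]
      exact degree_sub_lt_left (by rw [degree_X_pow, degree_eq_natDegree hf.ne_zero]) hf.ne_zero
        (by rw [hf.leadingCoeff, leadingCoeff_X_pow])
    exact ⟨degreeLTEquiv K _ ⟨_, h⟩, by simp⟩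

theorem add_mem_monics {n : ℕ} {f w : K[X]} (hf : f ∈ monics K n) (hw : w.degree < n) :
    f + w ∈ monics K n := by
  rw [mem_monics] at *
  have h : w.degree < f.degree := by rw [degree_eq_natDegree hf.1.ne_zero, hf.2]; exact hw
  exact ⟨hf.1.add_of_left h, by rw [natDegree_add_eq_left_of_degree_lt h, hf.2]⟩

open Classical in
theorem card_monics_filter_dvd_sub {w : K[X]} (hw : w.Monic) (r : K[X]) {n : ℕ}
    (hn : w.natDegree ≤ n) :
    ((monics K n).filter fun g => w ∣ g - r).card = Fintype.card K ^ (n - w.natDegree) := by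
  rw [← card_monics]
  symm
  have hr : (r %ₘ w).degree < w.degree := degree_modByMonic_lt _ hw
  have hrd : w ∣ r - r %ₘ w := ⟨r /ₘ w, by
    conv_lhs => enter [1]; rw [← modByMonic_add_div r w]
    ring⟩
  refine Finset.card_bij (fun k _ => w * k + r %ₘ w) ?_ ?_ ?_
  · intro k hk
    have hk' := mem_monics.mp hk
    rw [Finset.mem_filter]
    constructor
    · have h1 : w * k ∈ monics K n :=
        mem_monics.mpr ⟨hw.mul hk'.1, by rw [hw.natDegree_mul hk'.1, hk'.2]; omega⟩
      refine add_mem_monics h1 (hr.trans_le ?_)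
      rw [degree_eq_natDegree hw.ne_zero]
      exact_mod_cast hn
    · have : w * k + r %ₘ w - r = w * k - (r - r %ₘ w) := by ring
      rw [this]
      exact dvd_sub (dvd_mul_right _ _) hrd
  · intro k _ k' _ h
    exact mul_left_cancel₀ hw.ne_zero (add_right_cancel h)
  · intro g hg
    obtain ⟨hg1, hg2⟩ := Finset.mem_filter.mp hg
    obtain ⟨hgm, hgd⟩ := mem_monics.mp hg1
    have h1 : w ∣ g - r %ₘ w := by
      have : g - r %ₘ w = (g - r) + (r - r %ₘ w) := by ring
      rw [this]; exact dvd_add hg2 hrd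
    obtain ⟨k, hk⟩ := h1
    refine ⟨k, ?_, by rw [← hk]; ring⟩
    have hlt : (r %ₘ w).degree < g.degree := by
      refine hr.trans_le ?_
      rw [degree_eq_natDegree hw.ne_zero, degree_eq_natDegree hgm.ne_zero, hgd]
      exact_mod_cast hn
    have hm : (w * k).Monic := by rw [← hk]; exact hgm.sub_of_left hlt
    have hkm : k.Monic := hw.of_mul_monic_left hm
    refine mem_monics.mpr ⟨hkm, ?_⟩
    have h2 := hw.natDegree_mul hkm
    rw [← hk, natDegree_eq_of_degree_eq (degree_sub_eq_left_of_degree_lt hlt), hgd] at h2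
    omega

open Classical in
theorem card_monics_filter_dvd {w : K[X]} (hw : w.Monic) {n : ℕ} (hn : w.natDegree ≤ n) :
    ((monics K n).filter fun g => w ∣ g).card = Fintype.card K ^ (n - w.natDegree) := by
  simpa using card_monics_filter_dvd_sub hw 0 hn

open Classical in
theorem card_monics_filter_dvd_and {u v : K[X]} (hu : u.Monic) (hv : v.Monic) (h : IsCoprime u v)
    (F : K[X]) {n : ℕ} (hn : u.natDegree + v.natDegree ≤ n) :
    ((monics K n).filter fun g => u ∣ g ∧ v ∣ F - g).card =
      Fintype.card K ^ (n - (u.natDegree + v.natDegree)) := by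
  obtain ⟨r, hr⟩ := exists_forall_dvd_and_dvd_sub_iff h F
  simp only [hr]
  rw [card_monics_filter_dvd_sub (hu.mul hv) r (by rwa [hu.natDegree_mul hv]), hu.natDegree_mul hv]

theorem card_mul_sum_eq_sum_sum_translate {M : Type*} [AddCommMonoid M] (G : Finset K[X])
    (w : K[X]) (hG : ∀ g ∈ G, ∀ s : K, g + C s * w ∈ G) (f : K[X] → M) :
    Fintype.card K • ∑ g ∈ G, f g = ∑ g ∈ G, ∑ s : K, f (g + C s * w) := by
  rw [Finset.sum_comm]
  have : ∀ s : K, ∑ g ∈ G, f (g + C s * w) = ∑ g ∈ G, f g := by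
    intro s
    refine Finset.sum_bij' (fun g _ => g + C s * w) (fun g _ => g + C (-s) * w)
      (fun g hg => hG g hg s) (fun g hg => hG g hg (-s)) ?_ ?_ ?_
    · intro g _; simp
    · intro g _; simp
    · intro g _; rfl
  simp [this]

end Monics

section Divisors

variable {K : Type*} [Field K] [Fintype K]

open Classical in
/-- The finite set of monic divisors of a nonzero polynomial. -/
noncomputable def monicDivisors (f : K[X]) : Finset K[X] :=
  (Finset.range (f.natDegree + 1)).biUnion fun i => (monics K i).filter (· ∣ f)

theorem mem_monicDivisors {f d : K[X]} (hf : f ≠ 0) :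
    d ∈ monicDivisors f ↔ d.Monic ∧ d ∣ f := by
  simp only [monicDivisors, Finset.mem_biUnion, Finset.mem_range, Finset.mem_filter, mem_monics]
  constructor
  · rintro ⟨i, _, h, h'⟩; exact ⟨h.1, h'⟩
  · rintro ⟨h, h'⟩
    exact ⟨d.natDegree, Nat.lt_succ_of_le (natDegree_le_of_dvd h' hf), ⟨h, rfl⟩, h'⟩

open Classical in
theorem sum_monicDivisors {M : Type*} [AddCommMonoid M] {f : K[X]} (φ : K[X] → M) :
    ∑ d ∈ monicDivisors f, φ d =
      ∑ i ∈ Finset.range (f.natDegree + 1), ∑ d ∈ (monics K i).filter (· ∣ f), φ d := by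
  refine Finset.sum_biUnion fun i _ j _ hij => ?_
  refine Finset.disjoint_left.mpr fun d hd hd' => hij ?_
  rw [← (mem_monics.mp (Finset.mem_filter.mp hd).1).2,
    (mem_monics.mp (Finset.mem_filter.mp hd').1).2]

theorem exists_monic_irreducible_dvd {K : Type*} [Field K] {f : K[X]} (h0 : f ≠ 0)
    (hu : ¬IsUnit f) : ∃ P : K[X], P.Monic ∧ Irreducible P ∧ P ∣ f := by
  classical
  obtain ⟨p, hp, hpf⟩ := WfDvdMonoid.exists_irreducible_factor hu h0
  exact ⟨normalize p, monic_normalize hp.ne_zero, (normalize_associated p).symm.irreducible hp,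
    (normalize_associated p).dvd.trans hpf⟩

theorem card_monicDivisors_le {f : K[X]} (hf : f.Monic) :
    (monicDivisors f).card ≤ 2 ^ f.natDegree := by
  classical
  induction hN : f.natDegree using Nat.strong_induction_on generalizing f with
  | _ N ih =>
    by_cases hu : IsUnit f
    · obtain rfl := hf.eq_one_of_isUnit hu
      have : monicDivisors (1 : K[X]) ⊆ {1} := by
        intro d hd
        obtain ⟨h1, h2⟩ := (mem_monicDivisors one_ne_zero).mp hd
        rw [Finset.mem_singleton]
        exact h1.eq_one_of_isUnit (isUnit_of_dvd_one h2)
      exact (Finset.card_le_card this).trans (by simp [Nat.one_le_two_pow])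
    · obtain ⟨P, hP, hirr, g, rfl⟩ := exists_monic_irreducible_dvd hf.ne_zero hu
      have hg : g.Monic := hP.of_mul_monic_left hf
      have hdeg := hP.natDegree_mul hg
      have hpos := hirr.natDegree_pos
      have hsub : monicDivisors (P * g) ⊆
          monicDivisors g ∪ (monicDivisors g).image (P * ·) := by
        intro d hd
        obtain ⟨h1, h2⟩ := (mem_monicDivisors hf.ne_zero).mp hd
        rw [Finset.mem_union, Finset.mem_image]
        by_cases hPd : P ∣ d
        · obtain ⟨e, rfl⟩ := hPd
          exact Or.inr ⟨e, (mem_monicDivisors hg.ne_zero).mpr ⟨hP.of_mul_monic_left h1,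
            (mul_dvd_mul_iff_left hP.ne_zero).mp h2⟩, rfl⟩
        · exact Or.inl ((mem_monicDivisors hg.ne_zero).mpr ⟨h1,
            (((hirr.coprime_iff_not_dvd).mpr hPd).symm).dvd_of_dvd_mul_left h2⟩)
      have h3 := ih g.natDegree (by omega) hg rfl
      calc (monicDivisors (P * g)).card ≤ (monicDivisors g).card + (monicDivisors g).card :=
            (Finset.card_le_card hsub).trans ((Finset.card_union_le _ _).trans
              (Nat.add_le_add_left Finset.card_image_le _))
        _ ≤ 2 ^ g.natDegree + 2 ^ g.natDegree := Nat.add_le_add h3 h3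
        _ = 2 ^ (g.natDegree + 1) := by ring
        _ ≤ 2 ^ N := Nat.pow_le_pow_right (by norm_num) (by omega)

theorem monicDivisors_one : monicDivisors (1 : K[X]) = {1} := by
  ext d
  rw [mem_monicDivisors one_ne_zero, Finset.mem_singleton]
  exact ⟨fun h => h.1.eq_one_of_isUnit (isUnit_of_dvd_one h.2),
    by rintro rfl; exact ⟨monic_one, dvd_rfl⟩⟩

variable [DecidableEq K]

theorem sum_monicDivisors_polyMu_mul (hq : Odd (Fintype.card K)) {P w : K[X]} (hP : P.Monic)
    (hirr : Irreducible P) (hw : w.Monic) (hPw : ¬P ∣ w) (k : ℕ) (ψ : K[X] → ℤ) :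
    ∑ d ∈ monicDivisors (P ^ (k + 1) * w), polyMu d * ψ d =
      ∑ e ∈ monicDivisors w, polyMu e * (ψ e - ψ (P * e)) := by
  classical
  have hf : (P ^ (k + 1) * w).Monic := (hP.pow _).mul hw
  have hPe : ∀ e ∈ monicDivisors w, e.Monic ∧ e ∣ w ∧ ¬P ∣ e := fun e he =>
    have h := (mem_monicDivisors hw.ne_zero).mp he
    ⟨h.1, h.2, fun h' => hPw (h'.trans h.2)⟩
  have hdisj : Disjoint (monicDivisors w) ((monicDivisors w).image (P * ·)) := by
    refine Finset.disjoint_left.mpr fun d hd hd' => ?_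
    obtain ⟨e, _, rfl⟩ := Finset.mem_image.mp hd'
    exact (hPe _ hd).2.2 (dvd_mul_right _ _)
  have hsub : monicDivisors w ∪ (monicDivisors w).image (P * ·) ⊆
      monicDivisors (P ^ (k + 1) * w) := by
    intro d hd
    rw [mem_monicDivisors hf.ne_zero]
    rcases Finset.mem_union.mp hd with hd | hd
    · exact ⟨(hPe _ hd).1, (hPe _ hd).2.1.trans (dvd_mul_left _ _)⟩
    · obtain ⟨e, he, rfl⟩ := Finset.mem_image.mp hd
      exact ⟨hP.mul (hPe _ he).1, mul_dvd_mul (dvd_pow_self _ (Nat.succ_ne_zero k)) (hPe _ he).2.1⟩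
  rw [← Finset.sum_subset hsub, Finset.sum_union hdisj, Finset.sum_image, ← Finset.sum_add_distrib]
  · refine Finset.sum_congr rfl fun e he => ?_
    rw [polyMu_irreducible_mul hP hirr hq (hPe e he).1 (hPe e he).2.2]
    ring
  · intro a _ b _ h; exact mul_left_cancel₀ hP.ne_zero h
  · intro d hd hd'
    obtain ⟨h1, h2⟩ := (mem_monicDivisors hf.ne_zero).mp hd
    have hcop : ∀ e : K[X], ¬P ∣ e → e ∣ P ^ (k + 1) * w → e ∣ w := fun e he h =>
      ((((hirr.coprime_iff_not_dvd).mpr he).symm).pow_right).dvd_of_dvd_mul_left h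
    suffices h : P ^ 2 ∣ d by
      rw [polyMu_eq_zero_of_sq_dvd h1 hirr.not_isUnit h, zero_mul]
    rw [Finset.mem_union, Finset.mem_image, not_or] at hd'
    by_cases hPd : P ∣ d
    · obtain ⟨e, rfl⟩ := hPd
      have he : e.Monic := hP.of_mul_monic_left h1
      by_cases hPe' : P ∣ e
      · rw [pow_two]; exact mul_dvd_mul_left _ hPe'
      · exfalso
        exact hd'.2 ⟨e, (mem_monicDivisors hw.ne_zero).mpr
          ⟨he, hcop e hPe' ((dvd_mul_left _ _).trans h2)⟩, rfl⟩
    · exfalso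
      exact hd'.1 ((mem_monicDivisors hw.ne_zero).mpr ⟨h1, hcop d hPd h2⟩)

theorem exists_eq_pow_mul_of_monic {K : Type*} [Field K] {f : K[X]} (hf : f.Monic) (h1 : f ≠ 1) :
    ∃ (P w : K[X]) (k : ℕ), P.Monic ∧ Irreducible P ∧ w.Monic ∧ ¬P ∣ w ∧ f = P ^ (k + 1) * w := by
  have hu : ¬IsUnit f := fun h => h1 (hf.eq_one_of_isUnit h)
  obtain ⟨P, hP, hirr, hPf⟩ := exists_monic_irreducible_dvd hf.ne_zero hu
  obtain ⟨w, hw, hn⟩ := (FiniteMultiplicity.of_not_isUnit hirr.not_isUnit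
    hf.ne_zero).exists_eq_pow_mul_and_not_dvd
  have hpos : multiplicity P f ≠ 0 := by
    intro h0
    rw [h0, pow_zero, one_mul] at hw
    exact hn (hw ▸ hPf)
  obtain ⟨k, hk⟩ := Nat.exists_eq_succ_of_ne_zero hpos
  rw [hk] at hw
  refine ⟨P, w, k, hP, hirr, (hP.pow _).of_mul_monic_left (hw ▸ hf), hn, hw⟩

theorem sum_monicDivisors_polyMu (hq : Odd (Fintype.card K)) {f : K[X]} (hf : f.Monic)
    (h1 : f ≠ 1) : ∑ d ∈ monicDivisors f, polyMu d = 0 := by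
  obtain ⟨P, w, k, hP, hirr, hw, hn, rfl⟩ := exists_eq_pow_mul_of_monic hf h1
  simpa using sum_monicDivisors_polyMu_mul hq hP hirr hw hn k (fun _ => 1)

/-- A weighted sum of the Möbius function over divisors, equal to the degree on irreducible
polynomials and supported on prime powers. -/
noncomputable def mangoldt (m : ℕ) (f : K[X]) : ℤ :=
  ∑ d ∈ monicDivisors f, polyMu d * ((m : ℤ) - d.natDegree)

theorem mangoldt_pow_mul (hq : Odd (Fintype.card K)) (m : ℕ) {P w : K[X]} (hP : P.Monic)
    (hirr : Irreducible P) (hw : w.Monic) (hPw : ¬P ∣ w) (k : ℕ) :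
    mangoldt m (P ^ (k + 1) * w) = if w = 1 then (P.natDegree : ℤ) else 0 := by
  rw [mangoldt, sum_monicDivisors_polyMu_mul hq hP hirr hw hPw]
  have : ∀ e ∈ monicDivisors w, polyMu e * ((m : ℤ) - e.natDegree - (m - (P * e).natDegree)) =
      polyMu e * P.natDegree := by
    intro e he
    rw [hP.natDegree_mul ((mem_monicDivisors hw.ne_zero).mp he).1]
    push_cast; ring
  rw [Finset.sum_congr rfl this, ← Finset.sum_mul]
  split_ifs with h
  · rw [h, monicDivisors_one, Finset.sum_singleton, polyMu_one, one_mul]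
  · rw [sum_monicDivisors_polyMu hq hw h, zero_mul]

theorem mangoldt_irreducible (hq : Odd (Fintype.card K)) (m : ℕ) {P : K[X]} (hP : P.Monic)
    (hirr : Irreducible P) : mangoldt m P = P.natDegree := by
  have := mangoldt_pow_mul hq m hP hirr monic_one
    (fun h => hirr.not_isUnit (isUnit_of_dvd_one h)) 0
  simpa using this

theorem mangoldt_eq_zero_or (hq : Odd (Fintype.card K)) (m : ℕ) {f : K[X]} (hf : f.Monic)
    (h1 : f ≠ 1) (hirr : ¬Irreducible f) : mangoldt m f = 0 ∨
      (∃ (P : K[X]) (k : ℕ), P.Monic ∧ 2 ≤ k ∧ f = P ^ k) := by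
  obtain ⟨P, w, k, hP, hPi, hw, hn, rfl⟩ := exists_eq_pow_mul_of_monic hf h1
  rw [mangoldt_pow_mul hq m hP hPi hw hn]
  split_ifs with h
  · right
    refine ⟨P, k + 1, hP, ?_, by rw [h, mul_one]⟩
    rcases k with _ | k
    · exfalso; apply hirr; simpa [h] using hPi
    · omega
  · exact Or.inl rfl

end Divisors

section Line

variable {K : Type*} [Field K]

theorem coeff_X_mul_derivative (p : K[X]) (n : ℕ) :
    (X * derivative p).coeff n = n * p.coeff n := by
  cases n with
  | zero => simp
  | succ n => rw [coeff_X_mul, coeff_derivative]; push_cast; ring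

theorem natDegree_wronskian_of_monic {A B : K[X]} (hA : A.Monic) (hB : B ≠ 0) {r : ℕ}
    (hr : B.natDegree + r = A.natDegree) (hrK : (r : K) ≠ 0) :
    (derivative A * B - A * derivative B).natDegree + 1 = A.natDegree + B.natDegree := by
  have hXd : ∀ p : K[X], (X * derivative p).natDegree ≤ p.natDegree := by
    intro p
    rw [natDegree_le_iff_coeff_eq_zero]
    intro n hn
    rw [coeff_X_mul_derivative, coeff_eq_zero_of_natDegree_lt hn, mul_zero]
  have hX : X * (derivative A * B - A * derivative B) =
      (X * derivative A) * B - A * (X * derivative B) := by ring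
  have hcoeff : (X * (derivative A * B - A * derivative B)).coeff (A.natDegree + B.natDegree) =
      r * B.leadingCoeff := by
    rw [hX, coeff_sub, coeff_mul_add_eq_of_natDegree_le (hXd A) le_rfl,
      coeff_mul_add_eq_of_natDegree_le le_rfl (hXd B), coeff_X_mul_derivative,
      coeff_X_mul_derivative, hA.coeff_natDegree, coeff_natDegree, ← hr]
    push_cast; ring
  have hne : r * B.leadingCoeff ≠ 0 := mul_ne_zero hrK (leadingCoeff_ne_zero.mpr hB)
  have hle : (X * (derivative A * B - A * derivative B)).natDegree ≤
      A.natDegree + B.natDegree := by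
    rw [hX]
    refine (natDegree_sub_le _ _).trans (max_le ?_ ?_)
    · exact natDegree_mul_le.trans (Nat.add_le_add_right (hXd A) _)
    · exact natDegree_mul_le.trans (Nat.add_le_add_left (hXd B) _)
  have hW : derivative A * B - A * derivative B ≠ 0 := by
    intro h
    rw [h] at hcoeff
    exact hne (by simpa using hcoeff.symm)
  have heq : (X * (derivative A * B - A * derivative B)).natDegree =
      A.natDegree + B.natDegree :=
    natDegree_eq_of_le_of_coeff_ne_zero hle (by rw [hcoeff]; exact hne)
  rwa [natDegree_X_mul hW] at heq

/-- The resultant of a monic polynomial with the members of a pencil is a polynomial in the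
parameter. -/
theorem exists_resultant_pencil {W A B : K[X]} (hW : W.Monic)
    (hBA : B.degree < A.degree) (hWB : IsCoprime W B) :
    ∃ P : K[X], P.natDegree = W.natDegree ∧ ∀ s, P.eval s = resultant W (A + C s * B) := by
  let Kb := AlgebraicClosure K
  let ι := algebraMap K Kb
  set D := W.natDegree
  set N := A.natDegree
  let P : K[X] := resultant (W.map C) (A.map C + C X * B.map C) D N
  have hdeg : ∀ s, (A + C s * B).natDegree = N := fun s =>
    natDegree_add_eq_left_of_degree_lt
      ((by rw [← smul_eq_C_mul]; exact degree_smul_le s B : (C s * B).degree ≤ B.degree).trans_lt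
        hBA)
  have hev : ∀ s : Kb, eval s (P.map ι) =
      resultant (W.map ι) (A.map ι + C s * B.map ι) D N := by
    intro s
    rw [eval_map, ← coe_eval₂RingHom, ← resultant_map_map]
    congr 1
    · rw [Polynomial.map_map]; congr 1; ext x; simp
    · rw [Polynomial.map_add, Polynomial.map_mul, Polynomial.map_map, Polynomial.map_map, map_C]
      congr 2
      · ext x; simp
      · simp
      · congr 1; ext x; simp
  have hprod : P.map ι = ((W.map ι).roots.map fun ω =>
      C (aeval ω B) * X + C (aeval ω A)).prod := by
    refine Polynomial.funext fun s => ?_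
    have hs : (W.map ι).Splits := IsAlgClosed.splits _
    have h1 := resultant_eq_prod_eval (W.map ι) (A.map ι + C s * B.map ι) N (by
      refine (natDegree_add_le _ _).trans (max_le natDegree_map_le ?_)
      refine (natDegree_C_mul_le _ _).trans (natDegree_map_le.trans ?_)
      exact natDegree_le_natDegree hBA.le) hs
    rw [natDegree_map, (hW.map _).leadingCoeff, one_pow, one_mul] at h1
    rw [hev, h1, eval_multiset_prod, Multiset.map_map]
    congr 1
    refine Multiset.map_congr rfl fun ω _ => ?_
    simp only [Function.comp_apply, eval_add, eval_mul, eval_C, eval_X]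
    rw [eval_map_algebraMap, eval_map_algebraMap]
    ring
  have hB0 : ∀ ω ∈ (W.map ι).roots, aeval ω B ≠ 0 := by
    intro ω hω h
    rw [mem_roots (hW.map _).ne_zero, IsRoot, eval_map_algebraMap] at hω
    obtain ⟨a, b, hab⟩ := hWB
    have := congrArg (aeval ω) hab
    simp [hω, h] at this
  refine ⟨P, ?_, ?_⟩
  · rw [← natDegree_map ι, hprod, natDegree_multiset_prod]
    · rw [Multiset.map_map]
      have h1 : ∀ ω ∈ (W.map ι).roots, (natDegree ∘ fun ω =>
          C (aeval ω B) * X + C (aeval ω A)) ω = 1 := by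
        intro ω hω
        exact natDegree_linear (hB0 ω hω)
      rw [Multiset.map_congr rfl h1, Multiset.map_const', Multiset.sum_replicate, smul_eq_mul,
        mul_one, ← (IsAlgClosed.splits (W.map ι)).natDegree_eq_card_roots, natDegree_map]
    · intro h0
      obtain ⟨ω, hω, h⟩ := Multiset.mem_map.mp h0
      have := natDegree_linear (R := Kb) (b := aeval ω A) (hB0 ω hω)
      rw [h] at this
      simp at this
  · intro s
    rw [← coe_evalRingHom, ← resultant_map_map, hdeg]
    congr 1
    · rw [Polynomial.map_map]
      conv_rhs => rw [← Polynomial.map_id (p := W)]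
      congr 1; ext x; simp
    · rw [Polynomial.map_add, Polynomial.map_mul, Polynomial.map_map, Polynomial.map_map, map_C]
      have : (evalRingHom s).comp C = RingHom.id K := by ext x; simp
      rw [this, Polynomial.map_id, Polynomial.map_id]
      simp

theorem resultant_eq_of_eq_C_mul {f g g₁ : K[X]} {β : K} (hg : g = C β * g₁) (hβ : β ≠ 0) :
    resultant f g = β ^ f.natDegree * ((-1) ^ (f.natDegree * g₁.natDegree) *
      resultant g₁ f) := by
  subst hg
  rw [natDegree_C_mul hβ, resultant_C_mul_right, resultant_comm]

variable [Fintype K] [DecidableEq K]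

/-- Along a line the Möbius function is a quadratic character of a polynomial. -/
theorem exists_polyMu_line {A B : K[X]} (hA : A.Monic) (hB : Squarefree B)
    (hAB : IsCoprime A B) {r : ℕ} (hr : B.natDegree + r = A.natDegree) (hr0 : 0 < r)
    (hrK : (r : K) ≠ 0) :
    ∃ (P : K[X]) (ε : ℤ), |ε| ≤ 1 ∧ P.natDegree + 1 = A.natDegree + B.natDegree ∧
      ∀ s, polyMu (A + C s * B) = ε * quadraticChar K (P.eval s) := by
  have hB0 : B ≠ 0 := hB.ne_zero
  set N := A.natDegree with hN
  set W := derivative A * B - A * derivative B with hWdef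
  have hWdeg := natDegree_wronskian_of_monic hA hB0 hr hrK
  rw [← hWdef] at hWdeg
  have hBA : B.degree < A.degree := by
    rw [degree_eq_natDegree hB0, degree_eq_natDegree hA.ne_zero]
    exact_mod_cast (by omega : B.natDegree < A.natDegree)
  have hsep : B.Separable := PerfectField.separable_iff_squarefree.mpr hB
  have hWB : IsCoprime W B := by
    have h1 : IsCoprime (A * derivative B) B := hAB.mul_left hsep.symm
    have h2 : W = -(A * derivative B) + B * derivative A := by rw [hWdef]; ring
    rw [h2]
    exact (IsCoprime.neg_left h1).add_mul_left_left _
  have hW0 : W ≠ 0 := by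
    intro h
    rw [h] at hWdeg
    rw [h, isCoprime_zero_left] at hWB
    have := natDegree_eq_zero_of_isUnit hWB
    simp at hWdeg
    have hr1 : r = 1 := by omega
    rw [hWdef] at h
    have hc := eq_C_of_natDegree_eq_zero this
    have hA1 := eq_X_add_C_of_natDegree_le_one (p := A) (by omega)
    have hl : A.coeff 1 = 1 := by
      have := hA.coeff_natDegree
      rwa [show A.natDegree = 1 by omega] at this
    rw [hc, hA1, hl] at h
    simp at h
    rw [hc, h] at hB0
    simp at hB0
  have hω : W.leadingCoeff ≠ 0 := leadingCoeff_ne_zero.mpr hW0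
  have hβ : B.leadingCoeff ≠ 0 := leadingCoeff_ne_zero.mpr hB0
  have hmon : ∀ p : K[X], p ≠ 0 → ∃ p₁ : K[X], p₁.Monic ∧ p = C p.leadingCoeff * p₁ ∧
      p₁.natDegree = p.natDegree := by
    intro p hp
    have hl := leadingCoeff_ne_zero.mpr hp
    refine ⟨C p.leadingCoeff⁻¹ * p, ?_, ?_, natDegree_C_mul (inv_ne_zero hl)⟩
    · rw [Monic, leadingCoeff_mul, leadingCoeff_C, inv_mul_cancel₀ hl]
    · rw [← mul_assoc, ← C_mul, mul_inv_cancel₀ hl, C_1, one_mul]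
  obtain ⟨W₁, hW₁, hWW, hWd⟩ := hmon W hW0
  obtain ⟨B₁, hB₁, hBB, hBd⟩ := hmon B hB0
  have hW₁B : IsCoprime W₁ B :=
    hWB.of_isCoprime_of_dvd_left ⟨C W.leadingCoeff, by rw [mul_comm]; exact hWW⟩
  have hAB₁ : IsCoprime B₁ A :=
    (hAB.of_isCoprime_of_dvd_right ⟨C B.leadingCoeff, by rw [mul_comm]; exact hBB⟩).symm
  obtain ⟨P, hPd, hP⟩ := exists_resultant_pencil hW₁ hBA hW₁B
  set c₁ := B.leadingCoeff ^ N * ((-1) ^ (N * B₁.natDegree) * resultant B₁ A) with hc₁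
  set c₂ := W.leadingCoeff ^ N * (-1) ^ (N * W₁.natDegree) with hc₂
  have hc₁0 : c₁ ≠ 0 := mul_ne_zero (pow_ne_zero _ hβ) (mul_ne_zero (pow_ne_zero _ (by simp))
    ((resultant_ne_zero_iff_of_monic hB₁ A).mpr hAB₁))
  have hdlt : ∀ s, (C s * B).degree < A.degree := fun s =>
    (by rw [← smul_eq_C_mul]; exact degree_smul_le s B : (C s * B).degree ≤ B.degree).trans_lt hBA
  have hfm : ∀ s, (A + C s * B).Monic := fun s => hA.add_of_left (hdlt s)
  have hfd : ∀ s, (A + C s * B).natDegree = N := fun s =>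
    natDegree_add_eq_left_of_degree_lt (hdlt s)
  have hkey : ∀ s, resultant (A + C s * B) (derivative (A + C s * B)) * c₁ = c₂ * P.eval s := by
    intro s
    have h1 : resultant (A + C s * B) B = c₁ := by
      have h3 : resultant B₁ (A + C s * B) = resultant B₁ A := by
        refine resultant_congr_of_monic hB₁ ?_
        rw [add_sub_cancel_left]
        exact Dvd.dvd.mul_left ⟨C B.leadingCoeff, by rw [mul_comm]; exact hBB⟩ _
      rw [resultant_eq_of_eq_C_mul hBB hβ, h3, hfd]
    have h2 : resultant (A + C s * B) W = c₂ * P.eval s := by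
      rw [resultant_eq_of_eq_C_mul hWW hω, ← hP, hfd, hc₂]
      ring
    rw [← h1, ← h2, ← resultant_mul_right_of_monic (hfm s)]
    refine resultant_congr_of_monic (hfm s) ⟨derivative B, ?_⟩
    rw [hWdef, derivative_add, derivative_mul, derivative_C]
    ring
  refine ⟨P, (-1) ^ N * quadraticChar K ((-1) ^ (N * (N - 1) / 2)) * quadraticChar K c₁ *
    quadraticChar K c₂, ?_, by rw [hPd, hWd, hWdeg], ?_⟩
  · have hχ : ∀ x : K, |quadraticChar K x| ≤ 1 := by
      intro x
      by_cases h : x = 0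
      · simp [h]
      · rcases quadraticChar_dichotomy h with h | h <;> simp [h]
    rw [abs_mul, abs_mul, abs_mul, abs_neg_one_pow, one_mul]
    exact mul_le_one₀ (mul_le_one₀ (hχ _) (abs_nonneg _) (hχ _)) (abs_nonneg _) (hχ _)
  · intro s
    have h1 : quadraticChar K (resultant (A + C s * B) (derivative (A + C s * B))) *
        quadraticChar K c₁ = quadraticChar K c₂ * quadraticChar K (P.eval s) := by
      rw [← map_mul, ← map_mul, hkey]
    have h2 : quadraticChar K c₁ * quadraticChar K c₁ = 1 := by
      rw [← pow_two]; exact quadraticChar_sq_one hc₁0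
    rw [polyMu, monicDiscr, map_mul]
    generalize resultant (A + C s * B) (derivative (A + C s * B)) = R at h1
    rw [hfd]
    linear_combination (-1) ^ N * quadraticChar K ((-1) ^ (N * (N - 1) / 2)) *
      quadraticChar K c₁ * h1 - (-1) ^ N * quadraticChar K ((-1) ^ (N * (N - 1) / 2)) *
      quadraticChar K R * h2

end Line

section Divisors

variable {K : Type*} [Field K] [Fintype K]

theorem sum_monicDivisors_divByMonic {M : Type*} [AddCommMonoid M] {f : K[X]} (hf : f.Monic)
    (φ : K[X] → M) : ∑ d ∈ monicDivisors f, φ (f /ₘ d) = ∑ d ∈ monicDivisors f, φ d := by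
  have key : ∀ d ∈ monicDivisors f, f /ₘ d ∈ monicDivisors f ∧ f /ₘ (f /ₘ d) = d := by
    intro d hd
    obtain ⟨hdm, e, rfl⟩ := (mem_monicDivisors hf.ne_zero).mp hd
    have he := hdm.of_mul_monic_left hf
    rw [mul_divByMonic_cancel_left _ hdm, mul_comm, mul_divByMonic_cancel_left _ he, mul_comm]
    exact ⟨(mem_monicDivisors hf.ne_zero).mpr ⟨he, dvd_mul_left _ _⟩, rfl⟩
  exact Finset.sum_nbij' (fun d => f /ₘ d) (fun d => f /ₘ d) (fun d hd => (key d hd).1)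
    (fun d hd => (key d hd).1) (fun d hd => (key d hd).2) (fun d hd => (key d hd).2)
    (fun d hd => rfl)

theorem mangoldt_eq_sum_truncated [DecidableEq K] (m : ℕ) {f : K[X]} (hf : f.Monic) :
    mangoldt m f = ∑ d ∈ monicDivisors f, (polyMu d * ((m - d.natDegree : ℕ) : ℤ) -
      polyMu (f /ₘ d) * ((f.natDegree - m - d.natDegree : ℕ) : ℤ)) := by
  have h : ∑ d ∈ monicDivisors f,
      polyMu (f /ₘ d) * ((f.natDegree - m - d.natDegree : ℕ) : ℤ) =
      ∑ d ∈ monicDivisors f, polyMu d * ((d.natDegree - m : ℕ) : ℤ) := by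
    rw [← sum_monicDivisors_divByMonic hf fun d => polyMu d * ((d.natDegree - m : ℕ) : ℤ)]
    refine Finset.sum_congr rfl fun d hd => ?_
    rw [natDegree_divByMonic _ ((mem_monicDivisors hf.ne_zero).mp hd).1]
    congr 2
    omega
  rw [Finset.sum_sub_distrib, h, ← Finset.sum_sub_distrib, mangoldt]
  refine Finset.sum_congr rfl fun d _ => ?_
  rw [← mul_sub]
  congr 1
  omega

open Classical in
/-- The monic `g` of degree `N` with `u ∣ g` and `v ∣ F - g`. -/
noncomputable def dvdClass (N : ℕ) (F u v : K[X]) : Finset K[X] :=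
  (monics K N).filter fun g => u ∣ g ∧ v ∣ F - g

theorem mem_dvdClass {N : ℕ} {F u v g : K[X]} :
    g ∈ dvdClass N F u v ↔ g ∈ monics K N ∧ u ∣ g ∧ v ∣ F - g := by
  simp [dvdClass]

theorem card_dvdClass {N : ℕ} {F u v : K[X]} (hu : u.Monic) (hv : v.Monic) (h : IsCoprime u v)
    (hn : u.natDegree + v.natDegree ≤ N) :
    (dvdClass N F u v).card = Fintype.card K ^ (N - (u.natDegree + v.natDegree)) :=
  card_monics_filter_dvd_and hu hv h F hn

theorem sub_mem_monics {n : ℕ} {F g : K[X]} (hF : F ∈ monics K n) (hn : n ≠ 0)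
    (hg : g ∈ monics K (n - 1)) : F - g ∈ monics K n := by
  rw [sub_eq_add_neg]
  refine add_mem_monics hF ?_
  rw [degree_neg, degree_eq_natDegree (mem_monics.mp hg).1.ne_zero, (mem_monics.mp hg).2]
  exact_mod_cast (by omega)

theorem sum_sum_monicDivisors_eq {M : Type*} [AddCommMonoid M] {n : ℕ} {F : K[X]}
    (hF : F ∈ monics K n) (hn : n ≠ 0) (Ψ : K[X] → K[X] → K[X] → M) :
    ∑ g ∈ monics K (n - 1), ∑ u ∈ monicDivisors g, ∑ v ∈ monicDivisors (F - g), Ψ u v g =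
      ∑ a ∈ Finset.range n, ∑ c ∈ Finset.range (n + 1), ∑ u ∈ monics K a, ∑ v ∈ monics K c,
        ∑ g ∈ dvdClass (n - 1) F u v, Ψ u v g := by
  classical
  have h1 : ∀ g ∈ monics K (n - 1),
      ∑ u ∈ monicDivisors g, ∑ v ∈ monicDivisors (F - g), Ψ u v g =
      ∑ a ∈ Finset.range n, ∑ c ∈ Finset.range (n + 1), ∑ u ∈ monics K a, ∑ v ∈ monics K c,
        if u ∣ g ∧ v ∣ F - g then Ψ u v g else 0 := by
    intro g hg
    rw [sum_monicDivisors, (mem_monics.mp hg).2, Nat.sub_add_cancel (by omega)]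
    refine Finset.sum_congr rfl fun a _ => ?_
    conv_rhs => rw [Finset.sum_comm]
    rw [Finset.sum_filter]
    refine Finset.sum_congr rfl fun u _ => ?_
    rw [sum_monicDivisors, (mem_monics.mp (sub_mem_monics hF hn hg)).2]
    split_ifs with hu
    · refine Finset.sum_congr rfl fun c _ => ?_
      rw [Finset.sum_filter]
      simp [hu]
    · simp [hu]
  rw [Finset.sum_congr rfl h1, Finset.sum_comm]
  refine Finset.sum_congr rfl fun a _ => ?_
  rw [Finset.sum_comm]
  refine Finset.sum_congr rfl fun c _ => ?_
  rw [Finset.sum_comm]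
  refine Finset.sum_congr rfl fun u _ => ?_
  rw [Finset.sum_comm]
  refine Finset.sum_congr rfl fun v _ => ?_
  rw [dvdClass, Finset.sum_filter]

theorem abs_sum_sum_monicDivisors_le {n : ℕ} {F : K[X]} (hF : F ∈ monics K n) (hn : n ≠ 0)
    (G : Finset K[X]) (hG : G ⊆ monics K (n - 1)) (Ψ : K[X] → K[X] → K[X] → ℝ) {B : ℝ}
    (hB : 0 ≤ B) (hΨ : ∀ u v g, |Ψ u v g| ≤ B) :
    ∑ g ∈ G, |∑ u ∈ monicDivisors g, ∑ v ∈ monicDivisors (F - g), Ψ u v g| ≤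
      G.card * (4 ^ n * B) := by
  rw [← nsmul_eq_mul]
  refine Finset.sum_le_card_nsmul _ _ _ fun g hg => ?_
  have hg := hG hg
  have h1 := card_monicDivisors_le (mem_monics.mp hg).1
  have h2 := card_monicDivisors_le (mem_monics.mp (sub_mem_monics hF hn hg)).1
  rw [(mem_monics.mp hg).2] at h1
  rw [(mem_monics.mp (sub_mem_monics hF hn hg)).2] at h2
  have h3 : ((monicDivisors g).card : ℝ) ≤ 2 ^ n := by
    exact_mod_cast h1.trans (Nat.pow_le_pow_right (by norm_num) (by omega))
  have h4 : ((monicDivisors (F - g)).card : ℝ) ≤ 2 ^ n := by exact_mod_cast h2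
  calc |∑ u ∈ monicDivisors g, ∑ v ∈ monicDivisors (F - g), Ψ u v g|
      ≤ ∑ u ∈ monicDivisors g, ∑ v ∈ monicDivisors (F - g), B :=
        (Finset.abs_sum_le_sum_abs _ _).trans (Finset.sum_le_sum fun u _ =>
          (Finset.abs_sum_le_sum_abs _ _).trans (Finset.sum_le_sum fun v _ => hΨ u v g))
    _ = (monicDivisors g).card * ((monicDivisors (F - g)).card * B) := by simp
    _ ≤ 2 ^ n * (2 ^ n * B) := by gcongr
    _ = 4 ^ n * B := by rw [← mul_assoc, ← mul_pow]; norm_num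

theorem abs_sum_dvdClass_total_le {n : ℕ} {F : K[X]} (hF : F ∈ monics K n) (hn : n ≠ 0)
    (Ψ : K[X] → K[X] → K[X] → ℝ) {B : ℝ}
    (hΨ : ∀ u v, u.Monic → v.Monic → |∑ g ∈ dvdClass (n - 1) F u v, Ψ u v g| ≤
      B / ((Fintype.card K : ℝ) ^ u.natDegree * (Fintype.card K : ℝ) ^ v.natDegree)) :
    |∑ g ∈ monics K (n - 1), ∑ u ∈ monicDivisors g, ∑ v ∈ monicDivisors (F - g), Ψ u v g| ≤
      n * (n + 1) * B := by
  have hq : (0 : ℝ) < Fintype.card K := by exact_mod_cast Fintype.card_pos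
  rw [sum_sum_monicDivisors_eq hF hn]
  have : ∀ a c : ℕ, |∑ u ∈ monics K a, ∑ v ∈ monics K c, ∑ g ∈ dvdClass (n - 1) F u v,
      Ψ u v g| ≤ B := by
    intro a c
    calc _ ≤ ∑ u ∈ monics K a, ∑ v ∈ monics K c,
          B / ((Fintype.card K : ℝ) ^ a * (Fintype.card K : ℝ) ^ c) := by
          refine (Finset.abs_sum_le_sum_abs _ _).trans (Finset.sum_le_sum fun u hu => ?_)
          refine (Finset.abs_sum_le_sum_abs _ _).trans (Finset.sum_le_sum fun v hv => ?_)
          have := hΨ u v (mem_monics.mp hu).1 (mem_monics.mp hv).1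
          rwa [(mem_monics.mp hu).2, (mem_monics.mp hv).2] at this
      _ = B := by
          rw [Finset.sum_const, Finset.sum_const, card_monics, card_monics, nsmul_eq_mul,
            nsmul_eq_mul]
          push_cast
          field_simp
  calc _ ≤ ∑ a ∈ Finset.range n, ∑ c ∈ Finset.range (n + 1), B := by
        refine (Finset.abs_sum_le_sum_abs _ _).trans (Finset.sum_le_sum fun a _ => ?_)
        exact (Finset.abs_sum_le_sum_abs _ _).trans (Finset.sum_le_sum fun c _ => this a c)
    _ = n * (n + 1) * B := by simp; ring

end Divisors

section MainTerm

variable {K : Type*} [Field K] [Fintype K]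

open Classical in
theorem card_monics_filter_dvd_le {w : K[X]} (hw : w.Monic) (n : ℕ) :
    (((monics K n).filter fun g => w ∣ g).card : ℝ) ≤
      (Fintype.card K : ℝ) ^ n / (Fintype.card K : ℝ) ^ w.natDegree := by
  have hq : (0 : ℝ) < Fintype.card K := by exact_mod_cast Fintype.card_pos
  by_cases hn : w.natDegree ≤ n
  · rw [card_monics_filter_dvd hw hn, Nat.cast_pow, pow_sub₀ _ hq.ne' hn, div_eq_mul_inv]
  · rw [Finset.filter_false_of_mem, Finset.card_empty, Nat.cast_zero]
    · positivity
    · intro g hg h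
      have := natDegree_le_of_dvd h (mem_monics.mp hg).1.ne_zero
      rw [(mem_monics.mp hg).2] at this
      exact hn this

open Classical in
theorem sum_sum_not_isCoprime_le (a c : ℕ) :
    ∑ u ∈ monics K a, ∑ v ∈ monics K c, (if IsCoprime u v then (0 : ℝ) else 1) ≤
      a * ((Fintype.card K : ℝ) ^ a * (Fintype.card K : ℝ) ^ c / Fintype.card K) := by
  have hq : (0 : ℝ) < Fintype.card K := by exact_mod_cast Fintype.card_pos
  have hq1 : (1 : ℝ) ≤ Fintype.card K := by exact_mod_cast Fintype.card_pos
  set q : ℝ := (Fintype.card K : ℝ)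
  have h1 : ∀ u ∈ monics K a, ∀ v ∈ monics K c, (if IsCoprime u v then (0 : ℝ) else 1) ≤
      ∑ i ∈ Finset.range a, ∑ e ∈ monics K (i + 1),
        (if e ∣ u then 1 else 0) * (if e ∣ v then 1 else 0) := by
    intro u hu v hv
    have hnn : ∀ i ∈ Finset.range a, ∀ e ∈ monics K (i + 1),
        (0 : ℝ) ≤ (if e ∣ u then 1 else 0) * (if e ∣ v then 1 else 0) := by
      intro i _ e _; positivity
    split_ifs with h
    · exact Finset.sum_nonneg fun i hi => Finset.sum_nonneg (hnn i hi)
    · have h0 : ¬IsUnit (EuclideanDomain.gcd u v) := by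
        rwa [EuclideanDomain.gcd_isUnit_iff]
      have h0' : EuclideanDomain.gcd u v ≠ 0 := by
        intro h'
        exact (mem_monics.mp hu).1.ne_zero (EuclideanDomain.gcd_eq_zero_iff.mp h').1
      obtain ⟨e, he, hei, hed⟩ := exists_monic_irreducible_dvd h0' h0
      have heu := hed.trans (EuclideanDomain.gcd_dvd_left u v)
      have hev := hed.trans (EuclideanDomain.gcd_dvd_right u v)
      have hd := natDegree_le_of_dvd heu (mem_monics.mp hu).1.ne_zero
      rw [(mem_monics.mp hu).2] at hd
      have hp := hei.natDegree_pos
      have hi : e.natDegree - 1 ∈ Finset.range a := by rw [Finset.mem_range]; omega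
      refine le_trans ?_ (Finset.single_le_sum (fun i hi => Finset.sum_nonneg (hnn i hi)) hi)
      refine le_trans ?_ (Finset.single_le_sum (hnn _ hi)
        (mem_monics.mpr ⟨he, (by omega : e.natDegree = e.natDegree - 1 + 1)⟩))
      simp [heu, hev]
  calc _ ≤ ∑ u ∈ monics K a, ∑ v ∈ monics K c, ∑ i ∈ Finset.range a, ∑ e ∈ monics K (i + 1),
        (if e ∣ u then (1 : ℝ) else 0) * (if e ∣ v then 1 else 0) :=
        Finset.sum_le_sum fun u hu => Finset.sum_le_sum fun v hv => h1 u hu v hv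
    _ = ∑ i ∈ Finset.range a, ∑ e ∈ monics K (i + 1),
        (∑ u ∈ monics K a, if e ∣ u then (1 : ℝ) else 0) *
          (∑ v ∈ monics K c, if e ∣ v then 1 else 0) := by
        simp_rw [Finset.sum_mul_sum]
        simp_rw [Finset.sum_comm (s := monics K c) (t := Finset.range a)]
        rw [Finset.sum_comm]
        refine Finset.sum_congr rfl fun i _ => ?_
        simp_rw [Finset.sum_comm (s := monics K c) (t := monics K (i + 1))]
        rw [Finset.sum_comm]
    _ ≤ ∑ i ∈ Finset.range a, ∑ e ∈ monics K (i + 1),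
        (q ^ a / q ^ (i + 1)) * (q ^ c / q ^ (i + 1)) := by
        refine Finset.sum_le_sum fun i _ => Finset.sum_le_sum fun e he => ?_
        rw [Finset.sum_boole, Finset.sum_boole]
        have h1 := card_monics_filter_dvd_le (mem_monics.mp he).1 a
        have h2 := card_monics_filter_dvd_le (mem_monics.mp he).1 c
        rw [(mem_monics.mp he).2] at h1 h2
        gcongr
    _ = ∑ i ∈ Finset.range a, q ^ a * q ^ c / q ^ (i + 1) := by
        refine Finset.sum_congr rfl fun i _ => ?_
        rw [Finset.sum_const, card_monics, nsmul_eq_mul, Nat.cast_pow]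
        change q ^ (i + 1) * _ = _
        field_simp
    _ ≤ ∑ i ∈ Finset.range a, q ^ a * q ^ c / q := by
        refine Finset.sum_le_sum fun i _ => ?_
        gcongr
        exact le_self_pow₀ hq1 (by omega)
    _ = a * (q ^ a * q ^ c / q) := by simp

variable [DecidableEq K]

theorem sum_range_sum_polyMu (hq : Odd (Fintype.card K)) (j : ℕ) :
    ∑ a ∈ Finset.range (j + 1), (∑ f ∈ monics K a, (polyMu f : ℝ)) / (Fintype.card K : ℝ) ^ a =
      if j = 0 then 1 else 0 := by
  classical
  have hq0 : (0 : ℝ) < Fintype.card K := by exact_mod_cast Fintype.card_pos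
  have h1 : ∑ f ∈ monics K j, ∑ d ∈ monicDivisors f, (polyMu d : ℝ) = if j = 0 then 1 else 0 := by
    split_ifs with h
    · subst h
      have : monics K 0 = {1} := by
        ext f
        rw [mem_monics, Finset.mem_singleton]
        exact ⟨fun h => h.1.natDegree_eq_zero.mp h.2, by rintro rfl; simp⟩
      simp [this, monicDivisors_one, polyMu_one]
    · refine Finset.sum_eq_zero fun f hf => ?_
      have hf := mem_monics.mp hf
      exact_mod_cast sum_monicDivisors_polyMu hq hf.1 (by rintro rfl; simp at hf; omega)
  have h2 : ∀ f ∈ monics K j, ∑ d ∈ monicDivisors f, (polyMu d : ℝ) =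
      ∑ a ∈ Finset.range (j + 1), ∑ d ∈ monics K a, if d ∣ f then (polyMu d : ℝ) else 0 := by
    intro f hf
    rw [sum_monicDivisors, (mem_monics.mp hf).2]
    exact Finset.sum_congr rfl fun a _ => Finset.sum_filter _ _
  rw [Finset.sum_congr rfl h2, Finset.sum_comm] at h1
  have h3 : ∀ a ∈ Finset.range (j + 1), ∑ f ∈ monics K j, ∑ d ∈ monics K a,
      (if d ∣ f then (polyMu d : ℝ) else 0) =
      (Fintype.card K : ℝ) ^ j * ((∑ f ∈ monics K a, (polyMu f : ℝ)) /
        (Fintype.card K : ℝ) ^ a) := by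
    intro a ha
    rw [Finset.sum_comm, Finset.sum_div, Finset.mul_sum]
    refine Finset.sum_congr rfl fun d hd => ?_
    have hd := mem_monics.mp hd
    have hja : a ≤ j := by rw [Finset.mem_range] at ha; omega
    rw [← Finset.sum_filter, Finset.sum_const, card_monics_filter_dvd hd.1 (by omega), hd.2,
      nsmul_eq_mul, Nat.cast_pow, pow_sub₀ _ hq0.ne' hja]
    field_simp
  rw [Finset.sum_congr rfl h3, ← Finset.mul_sum] at h1
  split_ifs at h1 ⊢ with h
  · subst h; simpa using h1
  · exact (mul_eq_zero.mp h1).resolve_left (by positivity)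

theorem sum_range_truncated_mul_sum_polyMu (hq : Odd (Fintype.card K)) {m N : ℕ} (hm : 1 ≤ m)
    (hN : m ≤ N) :
    ∑ a ∈ Finset.range N, ((m - a : ℕ) : ℝ) *
      ((∑ f ∈ monics K a, (polyMu f : ℝ)) / (Fintype.card K : ℝ) ^ a) = 1 := by
  set y : ℕ → ℝ := fun a => (∑ f ∈ monics K a, (polyMu f : ℝ)) / (Fintype.card K : ℝ) ^ a
  have h : ∀ m : ℕ, 1 ≤ m → ∑ a ∈ Finset.range m, ((m : ℝ) - a) * y a = 1 := by
    intro m hm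
    induction m, hm using Nat.le_induction with
    | base => simpa [y] using sum_range_sum_polyMu (K := K) hq 0
    | succ m hm ih =>
      have h1 := sum_range_sum_polyMu (K := K) hq m
      rw [if_neg (by omega)] at h1
      have h2 : ∑ a ∈ Finset.range (m + 1), (((m + 1 : ℕ) : ℝ) - a) * y a =
          ∑ a ∈ Finset.range (m + 1), ((m : ℝ) - a) * y a + ∑ a ∈ Finset.range (m + 1), y a := by
        rw [← Finset.sum_add_distrib]
        exact Finset.sum_congr rfl fun a _ => by push_cast; ring
      rw [h2, h1, Finset.sum_range_succ, ih]
      simp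
  rw [← h m hm]
  symm
  refine Finset.sum_subset_zero_on_sdiff (Finset.range_subset_range.mpr hN) ?_ ?_
  · intro a ha
    simp only [Finset.mem_sdiff, Finset.mem_range] at ha
    rw [Nat.sub_eq_zero_of_le (by omega)]
    simp
  · intro a ha
    rw [Finset.mem_range] at ha
    rw [Nat.cast_sub ha.le]

theorem abs_polyMu_le_one_real (f : K[X]) : |(polyMu f : ℝ)| ≤ 1 := by
  exact_mod_cast abs_polyMu_le_one f

open Classical in
theorem abs_sum_coprime_sub_le (hq : Odd (Fintype.card K)) {n m : ℕ} {F : K[X]}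
    (hF : F ∈ monics K n) (hm : 1 ≤ m) (hmn : 2 * m ≤ n) :
    |∑ g ∈ monics K (n - 1), ∑ u ∈ monicDivisors g, ∑ v ∈ monicDivisors (F - g),
        (if IsCoprime u v then (polyMu u : ℝ) * ((m - u.natDegree : ℕ) : ℝ) *
          (polyMu v * ((m - v.natDegree : ℕ) : ℝ)) else 0) - (Fintype.card K : ℝ) ^ (n - 1)| ≤
      n * (n + 1) * (n ^ 3 * ((Fintype.card K : ℝ) ^ (n - 1) / Fintype.card K)) := by
  have hq0 : (0 : ℝ) < Fintype.card K := by exact_mod_cast Fintype.card_pos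
  set q : ℝ := (Fintype.card K : ℝ) with hqdef
  have hmain : q ^ (n - 1) = ∑ a ∈ Finset.range n, ∑ c ∈ Finset.range (n + 1),
      ∑ u ∈ monics K a, ∑ v ∈ monics K c, (polyMu u : ℝ) * ((m - a : ℕ) : ℝ) *
          (polyMu v * ((m - c : ℕ) : ℝ)) * (q ^ (n - 1) / (q ^ a * q ^ c)) := by
    have h1 := sum_range_truncated_mul_sum_polyMu (K := K) hq hm (N := n) (by omega)
    have h2 := sum_range_truncated_mul_sum_polyMu (K := K) hq hm (N := n + 1) (by omega)
    rw [← hqdef] at h1 h2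
    calc q ^ (n - 1) = q ^ (n - 1) *
          ((∑ a ∈ Finset.range n, ((m - a : ℕ) : ℝ) *
            ((∑ f ∈ monics K a, (polyMu f : ℝ)) / q ^ a)) *
          (∑ a ∈ Finset.range (n + 1), ((m - a : ℕ) : ℝ) *
            ((∑ f ∈ monics K a, (polyMu f : ℝ)) / q ^ a))) := by rw [h1, h2]; ring
      _ = _ := by
        rw [Finset.sum_mul_sum, Finset.mul_sum]
        refine Finset.sum_congr rfl fun a _ => ?_
        rw [Finset.mul_sum]
        refine Finset.sum_congr rfl fun c _ => ?_
        have : ((m - a : ℕ) : ℝ) * ((∑ f ∈ monics K a, (polyMu f : ℝ)) / q ^ a) *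
            (((m - c : ℕ) : ℝ) * ((∑ f ∈ monics K c, (polyMu f : ℝ)) / q ^ c)) =
            (∑ f ∈ monics K a, (polyMu f : ℝ)) * (∑ f ∈ monics K c, (polyMu f : ℝ)) *
            (((m - a : ℕ) : ℝ) * ((m - c : ℕ) : ℝ) / (q ^ a * q ^ c)) := by
          field_simp
        rw [this, Finset.sum_mul_sum, Finset.sum_mul, Finset.mul_sum]
        refine Finset.sum_congr rfl fun u _ => ?_
        rw [Finset.sum_mul, Finset.mul_sum]
        refine Finset.sum_congr rfl fun v _ => ?_
        ring
  rw [sum_sum_monicDivisors_eq hF (by omega)]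
  conv_lhs => rw [hmain]
  rw [← Finset.sum_sub_distrib]
  have hcell : ∀ a ∈ Finset.range n, ∀ c ∈ Finset.range (n + 1),
      |∑ u ∈ monics K a, ∑ v ∈ monics K c, ∑ g ∈ dvdClass (n - 1) F u v,
        (if IsCoprime u v then (polyMu u : ℝ) * ((m - u.natDegree : ℕ) : ℝ) *
          (polyMu v * ((m - v.natDegree : ℕ) : ℝ)) else 0) -
        ∑ u ∈ monics K a, ∑ v ∈ monics K c, (polyMu u : ℝ) * ((m - a : ℕ) : ℝ) *
          (polyMu v * ((m - c : ℕ) : ℝ)) * (q ^ (n - 1) / (q ^ a * q ^ c))| ≤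
      n ^ 3 * (q ^ (n - 1) / q) := by
    intro a ha c hc
    rw [Finset.mem_range] at ha hc
    have hterm : ∀ u ∈ monics K a, ∀ v ∈ monics K c,
        |∑ g ∈ dvdClass (n - 1) F u v,
          (if IsCoprime u v then (polyMu u : ℝ) * ((m - u.natDegree : ℕ) : ℝ) *
            (polyMu v * ((m - v.natDegree : ℕ) : ℝ)) else 0) -
          (polyMu u : ℝ) * ((m - a : ℕ) : ℝ) *
          (polyMu v * ((m - c : ℕ) : ℝ)) * (q ^ (n - 1) / (q ^ a * q ^ c))| ≤
        n ^ 2 * (q ^ (n - 1) / (q ^ a * q ^ c)) * if IsCoprime u v then (0 : ℝ) else 1 := by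
      intro u hu v hv
      have hu := mem_monics.mp hu
      have hv := mem_monics.mp hv
      rw [Finset.sum_const, hu.2, hv.2, nsmul_eq_mul]
      split_ifs with h
      · by_cases hac : a < m ∧ c < m
        · rw [card_dvdClass hu.1 hv.1 h (by omega), hu.2, hv.2, Nat.cast_pow,
            pow_sub₀ _ hq0.ne' (by omega), pow_add, mul_comm (_ * _⁻¹), ← div_eq_mul_inv,
            sub_self, abs_zero, mul_zero]
        · have : (m - a : ℕ) = 0 ∨ (m - c : ℕ) = 0 := by omega
          rcases this with h0 | h0 <;> simp [h0]
      · rw [mul_zero, zero_sub, abs_neg, mul_one, abs_mul,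
          abs_of_nonneg (a := q ^ (n - 1) / (q ^ a * q ^ c)) (by positivity)]
        gcongr
        rw [abs_mul, abs_mul, abs_mul, Nat.abs_cast, Nat.abs_cast, pow_two]
        have h1 : ((m - a : ℕ) : ℝ) ≤ n := by exact_mod_cast (by omega)
        have h2 : ((m - c : ℕ) : ℝ) ≤ n := by exact_mod_cast (by omega)
        have h3 := abs_polyMu_le_one_real u
        have h4 := abs_polyMu_le_one_real v
        calc _ ≤ (1 * (n : ℝ)) * (1 * n) := by gcongr
          _ = n * n := by ring
    rw [← Finset.sum_sub_distrib]
    simp_rw [← Finset.sum_sub_distrib]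
    calc _ ≤ ∑ u ∈ monics K a, ∑ v ∈ monics K c,
          n ^ 2 * (q ^ (n - 1) / (q ^ a * q ^ c)) * (if IsCoprime u v then (0 : ℝ) else 1) := by
          refine (Finset.abs_sum_le_sum_abs _ _).trans (Finset.sum_le_sum fun u hu => ?_)
          exact (Finset.abs_sum_le_sum_abs _ _).trans (Finset.sum_le_sum fun v hv =>
            hterm u hu v hv)
      _ = n ^ 2 * (q ^ (n - 1) / (q ^ a * q ^ c)) * ∑ u ∈ monics K a, ∑ v ∈ monics K c,
          (if IsCoprime u v then (0 : ℝ) else 1) := by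
          simp_rw [Finset.mul_sum]
      _ ≤ n ^ 2 * (q ^ (n - 1) / (q ^ a * q ^ c)) * (n * (q ^ a * q ^ c / q)) := by
          gcongr
          refine (sum_sum_not_isCoprime_le a c).trans ?_
          gcongr
      _ = n ^ 3 * (q ^ (n - 1) / q) := by field_simp
  calc _ ≤ ∑ a ∈ Finset.range n, ∑ c ∈ Finset.range (n + 1), n ^ 3 * (q ^ (n - 1) / q) := by
        refine (Finset.abs_sum_le_sum_abs _ _).trans (Finset.sum_le_sum fun a ha => ?_)
        rw [← Finset.sum_sub_distrib]
        exact (Finset.abs_sum_le_sum_abs _ _).trans (Finset.sum_le_sum fun c hc => hcell a ha c hc)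
    _ = n * (n + 1) * (n ^ 3 * (q ^ (n - 1) / q)) := by simp; ring

end MainTerm

section Lines

variable {K : Type*} [Field K] [Fintype K] [DecidableEq K]

theorem two_ne_zero_of_odd_card {K : Type*} [Field K] [Fintype K] (hq : Odd (Fintype.card K)) :
    (2 : K) ≠ 0 :=
  Ring.two_ne_zero (ringChar_ne_two_of_odd_card hq)

theorem abs_sum_polyMu_line_le (hq : Odd (Fintype.card K)) {A B : K[X]} (hA : A.Monic)
    (hB : Squarefree B) (hAB : IsCoprime A B) (hr : B.natDegree + 2 = A.natDegree) :
    |∑ s : K, (polyMu (A + C s * B) : ℝ)| ≤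
      200 * A.natDegree * √(Fintype.card K : ℝ) := by
  obtain ⟨P, ε, hε, hP, h⟩ := exists_polyMu_line hA hB hAB hr two_pos
    (by exact_mod_cast two_ne_zero_of_odd_card hq)
  have hodd : Odd P.natDegree := by rw [Nat.odd_iff]; omega
  have h1 : ∑ s : K, (polyMu (A + C s * B) : ℝ) =
      ε * ∑ s : K, (quadraticChar K (P.eval s) : ℝ) := by
    rw [Finset.mul_sum]
    exact Finset.sum_congr rfl fun s _ => by rw [h]; push_cast; rfl
  have hε' : |(ε : ℝ)| ≤ 1 := by exact_mod_cast hε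
  have hP' : (P.natDegree : ℝ) ≤ 2 * A.natDegree := by exact_mod_cast (by omega)
  rw [h1, abs_mul]
  calc _ ≤ 1 * (100 * P.natDegree * √(Fintype.card K : ℝ)) := by
        gcongr; exact abs_sum_quadraticChar_le P hodd hq
    _ ≤ 1 * (100 * (2 * A.natDegree) * √(Fintype.card K : ℝ)) := by gcongr
    _ = _ := by ring

theorem abs_sum_polyMu_mul_polyMu_line_le (hq : Odd (Fintype.card K)) {A B A' B' : K[X]}
    (hA : A.Monic) (hB : Squarefree B) (hAB : IsCoprime A B) (hr : B.natDegree + 1 = A.natDegree)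
    (hA' : A'.Monic) (hB' : Squarefree B') (hAB' : IsCoprime A' B')
    (hr' : B'.natDegree + 2 = A'.natDegree) :
    |∑ s : K, (polyMu (A + C s * B) : ℝ) * polyMu (A' + C s * B')| ≤
      200 * (A.natDegree + A'.natDegree) * √(Fintype.card K : ℝ) := by
  obtain ⟨P, ε, hε, hP, h⟩ := exists_polyMu_line hA hB hAB hr one_pos (by simp)
  obtain ⟨P', ε', hε', hP', h'⟩ := exists_polyMu_line hA' hB' hAB' hr' two_pos
    (by exact_mod_cast two_ne_zero_of_odd_card hq)
  have hP'0 : P' ≠ 0 := by rintro rfl; simp at hP'; omega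
  by_cases hP0 : P = 0
  · have : ∀ s : K, (polyMu (A + C s * B) : ℝ) = 0 := by intro s; rw [h, hP0]; simp
    simp only [this, zero_mul, Finset.sum_const_zero, abs_zero]
    positivity
  have hd : (P * P').natDegree = P.natDegree + P'.natDegree := natDegree_mul hP0 hP'0
  have hodd : Odd (P * P').natDegree := by rw [hd, Nat.odd_iff]; omega
  have h1 : ∑ s : K, (polyMu (A + C s * B) : ℝ) * polyMu (A' + C s * B') =
      ε * ε' * ∑ s : K, (quadraticChar K ((P * P').eval s) : ℝ) := by
    rw [Finset.mul_sum]
    exact Finset.sum_congr rfl fun s _ => by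
      rw [h, h', eval_mul, map_mul]; push_cast; ring
  have h2 : |(ε : ℝ)| ≤ 1 := by exact_mod_cast hε
  have h3 : |(ε' : ℝ)| ≤ 1 := by exact_mod_cast hε'
  have hP' : ((P * P').natDegree : ℝ) ≤ 2 * (A.natDegree + A'.natDegree) := by
    exact_mod_cast (by omega)
  rw [h1, abs_mul, abs_mul]
  calc _ ≤ 1 * 1 * (100 * (P * P').natDegree * √(Fintype.card K : ℝ)) := by
        gcongr; exact abs_sum_quadraticChar_le _ hodd hq
    _ ≤ 1 * 1 * (100 * (2 * (A.natDegree + A'.natDegree)) * √(Fintype.card K : ℝ)) := by gcongr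
    _ = _ := by ring

theorem exists_finset_forall_eval_ne_zero {f : K[X]} (hf : f ≠ 0) {k : ℕ}
    (hk : f.natDegree + k ≤ Fintype.card K) :
    ∃ Z : Finset K, Z.card = k ∧ ∀ ζ ∈ Z, f.eval ζ ≠ 0 := by
  have h1 : k ≤ (Finset.univ \ f.roots.toFinset).card := by
    rw [Finset.card_sdiff_of_subset (Finset.subset_univ _), Finset.card_univ]
    have := (Multiset.toFinset_card_le f.roots).trans (card_roots' f)
    omega
  obtain ⟨Z, hZ, hc⟩ := Finset.exists_subset_card_eq h1
  refine ⟨Z, hc, fun ζ hζ h => ?_⟩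
  have := hZ hζ
  simp [hf] at this
  exact this h

theorem squarefree_mul_prod_X_sub_C {K : Type*} [Field K] [Fintype K] {f : K[X]}
    (hf : Squarefree f) {Z : Finset K}
    (hZ : ∀ ζ ∈ Z, f.eval ζ ≠ 0) : Squarefree (f * ∏ ζ ∈ Z, (X - C ζ)) := by
  rw [← PerfectField.separable_iff_squarefree]
  refine (PerfectField.separable_iff_squarefree.mpr hf).mul ?_ ?_
  · exact separable_prod_X_sub_C_iff'.mpr fun x _ y _ h => h
  · refine IsCoprime.prod_right fun ζ hζ => ?_
    refine ((irreducible_X_sub_C ζ).coprime_iff_not_dvd.mpr ?_).symm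
    rw [dvd_iff_isRoot]
    exact hZ ζ hζ

theorem abs_sum_dvdClass_le {n : ℕ} {F u v : K[X]} (hF : F ∈ monics K n) (hn : n ≠ 0)
    (hu : u.Monic) (hv : v.Monic) (hsq : Squarefree (u * v)) (hcop : IsCoprime (u * v) F)
    (hqn : n ≤ Fintype.card K) (k : ℕ) (hk : u.natDegree + v.natDegree + k + 1 < n)
    (φ : K[X] → K[X] → ℝ) (hφ : ∀ x y, |φ x y| ≤ 1) {M : ℝ} (hM : 0 ≤ M)
    (hline : ∀ ℓ x y : K[X], ℓ.natDegree = k → Squarefree (u * v * ℓ) → x.Monic → y.Monic →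
      u.natDegree + x.natDegree + 1 = n → v.natDegree + y.natDegree = n →
      IsCoprime x (v * ℓ) → IsCoprime y (u * ℓ) →
      |∑ s : K, φ (x + C s * (v * ℓ)) (y + C s * (-(u * ℓ)))| ≤ M * √(Fintype.card K : ℝ)) :
    |∑ g ∈ dvdClass (n - 1) F u v, φ (g /ₘ u) ((F - g) /ₘ v)| ≤
      (M + 2 * n) * ((Fintype.card K : ℝ) ^ (n - 1) / √(Fintype.card K : ℝ)) /
        ((Fintype.card K : ℝ) ^ u.natDegree * (Fintype.card K : ℝ) ^ v.natDegree) := by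
  classical
  have hq0 : (0 : ℝ) < Fintype.card K := by exact_mod_cast Fintype.card_pos
  have hq1 : (1 : ℝ) ≤ Fintype.card K := by exact_mod_cast Fintype.card_pos
  have huv : IsCoprime u v :=
    ((PerfectField.separable_iff_squarefree.mpr hsq).isCoprime)
  obtain ⟨Z, hZk, hZ⟩ := exists_finset_forall_eval_ne_zero (hu.mul hv).ne_zero (k := k)
    (by rw [hu.natDegree_mul hv]; omega)
  have hsqℓ := squarefree_mul_prod_X_sub_C hsq hZ
  set ℓ : K[X] := ∏ ζ ∈ Z, (X - C ζ) with hℓ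
  have hℓm : ℓ.Monic := monic_prod_of_monic _ _ fun ζ _ => monic_X_sub_C ζ
  have hℓd : ℓ.natDegree = k := by
    rw [hℓ, natDegree_prod_of_monic _ _ fun ζ _ => monic_X_sub_C ζ]; simp [hZk]
  set G := dvdClass (n - 1) F u v with hG
  set w := u * v * ℓ with hw
  have hwd : w.degree < ((n - 1 : ℕ) : WithBot ℕ) := by
    rw [degree_eq_natDegree ((hu.mul hv).mul hℓm).ne_zero, (hu.mul hv).natDegree_mul hℓm,
      hu.natDegree_mul hv, hℓd]
    exact_mod_cast (by omega)
  have hGw : ∀ g ∈ G, ∀ s : K, g + C s * w ∈ G := by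
    intro g hg s
    rw [hG, mem_dvdClass] at hg ⊢
    refine ⟨add_mem_monics hg.1 (lt_of_le_of_lt ?_ hwd), ?_, ?_⟩
    · rw [← smul_eq_C_mul]; exact degree_smul_le s w
    · exact dvd_add hg.2.1 ⟨C s * (v * ℓ), by rw [hw]; ring⟩
    · rw [← sub_sub]
      exact dvd_sub hg.2.2 ⟨C s * (u * ℓ), by rw [hw]; ring⟩
  set q : ℝ := (Fintype.card K : ℝ) with hqdef
  let ψ : K[X] → ℝ := fun g => φ (g /ₘ u) ((F - g) /ₘ v)
  set bad : Finset K[X] := Z.biUnion fun ζ =>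
    dvdClass (n - 1) F (u * (X - C ζ)) v ∪ dvdClass (n - 1) F u (v * (X - C ζ)) with hbad
  have hbadcard : (bad.card : ℝ) ≤
      2 * n * (q ^ (n - 1) / (q ^ u.natDegree * q ^ v.natDegree) / q) := by
    have h1 : bad.card ≤ Z.card *
        (2 * Fintype.card K ^ (n - 1 - (u.natDegree + v.natDegree + 1))) := by
      refine Finset.card_biUnion_le_card_mul _ _ _ fun ζ hζ => ?_
      refine (Finset.card_union_le _ _).trans ?_
      have hζu : ¬ (X - C ζ) ∣ u * v := by rw [dvd_iff_isRoot]; exact hZ ζ hζ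
      have hc1 : IsCoprime (X - C ζ) v := (irreducible_X_sub_C ζ).coprime_iff_not_dvd.mpr
        fun h => hζu (h.mul_left u)
      have hc2 : IsCoprime (X - C ζ) u := (irreducible_X_sub_C ζ).coprime_iff_not_dvd.mpr
        fun h => hζu (h.mul_right v)
      have hd1 : (u * (X - C ζ)).natDegree = u.natDegree + 1 := by
        rw [hu.natDegree_mul (monic_X_sub_C ζ), natDegree_X_sub_C]
      have hd2 : (v * (X - C ζ)).natDegree = v.natDegree + 1 := by
        rw [hv.natDegree_mul (monic_X_sub_C ζ), natDegree_X_sub_C]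
      rw [card_dvdClass (hu.mul (monic_X_sub_C ζ)) hv (huv.mul_left hc1) (by omega),
        card_dvdClass hu (hv.mul (monic_X_sub_C ζ)) (huv.mul_right hc2.symm) (by omega), hd1, hd2,
        two_mul, add_right_comm, add_assoc]
    calc (bad.card : ℝ) ≤ ((Z.card *
        (2 * Fintype.card K ^ (n - 1 - (u.natDegree + v.natDegree + 1))) : ℕ) : ℝ) := by
          exact_mod_cast h1
      _ = k * (2 * (q ^ (n - 1) / (q ^ u.natDegree * q ^ v.natDegree) / q)) := by
          push_cast
          rw [hZk, ← hqdef, pow_sub₀ _ hq0.ne' (by omega), pow_succ, pow_add]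
          field_simp
      _ ≤ n * (2 * (q ^ (n - 1) / (q ^ u.natDegree * q ^ v.natDegree) / q)) := by
          gcongr; omega
      _ = _ := by ring
  have hGcard : (G.card : ℝ) = q ^ (n - 1) / (q ^ u.natDegree * q ^ v.natDegree) := by
    rw [hG, card_dvdClass hu hv huv (by omega), Nat.cast_pow, pow_sub₀ _ hq0.ne' (by omega),
      pow_add, div_eq_mul_inv]
  have hψ : ∀ g, |∑ s : K, ψ (g + C s * w)| ≤ q := by
    intro g
    refine (Finset.abs_sum_le_sum_abs _ _).trans ?_
    calc _ ≤ ∑ s : K, (1 : ℝ) := Finset.sum_le_sum fun s _ => hφ _ _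
      _ = q := by simp [hqdef]
  have hgood : ∀ g ∈ G, g ∉ bad → |∑ s : K, ψ (g + C s * w)| ≤ M * √q := by
    intro g hg hgb
    have hg' := hg
    rw [hG, mem_dvdClass] at hg'
    obtain ⟨hgm, ⟨x, hx⟩, ⟨y, hy⟩⟩ := hg'
    have hhm := sub_mem_monics hF hn hgm
    have hxm : x.Monic := hu.of_mul_monic_left (hx ▸ (mem_monics.mp hgm).1)
    have hym : y.Monic := hv.of_mul_monic_left (hy ▸ (mem_monics.mp hhm).1)
    have hFxy : F = u * x + v * y := by rw [← hx, ← hy]; ring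
    have hxℓ : IsCoprime x ℓ := by
      refine IsCoprime.prod_right fun ζ hζ => ?_
      refine ((irreducible_X_sub_C ζ).coprime_iff_not_dvd.mpr fun h => hgb ?_).symm
      refine Finset.mem_biUnion.mpr ⟨ζ, hζ, Finset.mem_union_left _ ?_⟩
      exact mem_dvdClass.mpr ⟨hgm, by rw [hx]; exact mul_dvd_mul_left u h, ⟨y, hy⟩⟩
    have hyℓ : IsCoprime y ℓ := by
      refine IsCoprime.prod_right fun ζ hζ => ?_
      refine ((irreducible_X_sub_C ζ).coprime_iff_not_dvd.mpr fun h => hgb ?_).symm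
      refine Finset.mem_biUnion.mpr ⟨ζ, hζ, Finset.mem_union_right _ ?_⟩
      exact mem_dvdClass.mpr ⟨hgm, ⟨x, hx⟩, by rw [hy]; exact mul_dvd_mul_left v h⟩
    have hxv : IsCoprime x v := by
      have h1 : IsCoprime v (u * x + v * y) := hFxy ▸ hcop.of_mul_left_right
      exact ((IsCoprime.add_mul_left_right_iff).mp h1).of_mul_right_right.symm
    have hyu : IsCoprime y u := by
      have h1 : IsCoprime u (v * y + u * x) := by
        rw [add_comm]; exact hFxy ▸ hcop.of_mul_left_left
      exact ((IsCoprime.add_mul_left_right_iff).mp h1).of_mul_right_right.symm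
    have hdx := (mem_monics.mp hgm).2
    rw [hx, hu.natDegree_mul hxm] at hdx
    have hdy := (mem_monics.mp hhm).2
    rw [hy, hv.natDegree_mul hym] at hdy
    have h := hline ℓ x y hℓd hsqℓ hxm hym (by omega) hdy (hxv.mul_right hxℓ) (hyu.mul_right hyℓ)
    have heq : ∀ s : K, ψ (g + C s * w) = φ (x + C s * (v * ℓ)) (y + C s * (-(u * ℓ))) := by
      intro s
      have h1 : g + C s * w = u * (x + C s * (v * ℓ)) := by rw [hx, hw]; ring
      have h2 : F - (g + C s * w) = v * (y + C s * (-(u * ℓ))) := by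
        rw [← sub_sub, hy, hw]; ring
      simp only [ψ]
      rw [h2, h1, mul_divByMonic_cancel_left _ hu, mul_divByMonic_cancel_left _ hv]
    simpa only [heq] using h
  have htot : q * |∑ g ∈ G, ψ g| ≤ G.card * (M * √q) + bad.card * q := by
    have h1 := card_mul_sum_eq_sum_sum_translate G w hGw ψ
    rw [nsmul_eq_mul] at h1
    calc q * |∑ g ∈ G, ψ g| = |∑ g ∈ G, ∑ s : K, ψ (g + C s * w)| := by
          rw [← h1, abs_mul, Nat.abs_cast]
      _ ≤ ∑ g ∈ G, |∑ s : K, ψ (g + C s * w)| := Finset.abs_sum_le_sum_abs _ _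
      _ ≤ ∑ g ∈ G, (M * √q + if g ∈ bad then q else 0) := by
          refine Finset.sum_le_sum fun g hg => ?_
          split_ifs with h
          · have := hψ g
            have : 0 ≤ M * √q := by positivity
            linarith
          · rw [add_zero]; exact hgood g hg h
      _ = G.card * (M * √q) + (G.filter (· ∈ bad)).card * q := by
          rw [Finset.sum_add_distrib, Finset.sum_const, nsmul_eq_mul, ← Finset.sum_filter,
            Finset.sum_const, nsmul_eq_mul]
      _ ≤ G.card * (M * √q) + bad.card * q := by
          gcongr
          exact fun g hg => (Finset.mem_filter.mp hg).2
  set E := q ^ (n - 1) / (q ^ u.natDegree * q ^ v.natDegree) with hE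
  have hE0 : 0 ≤ E := by positivity
  have hs : √q * √q = q := Real.mul_self_sqrt hq0.le
  have hs1 : 1 ≤ √q := Real.one_le_sqrt.mpr hq1
  have hfin : |∑ g ∈ G, ψ g| ≤ (M + 2 * n) * E / √q := by
    rw [le_div_iff₀ (by positivity)]
    have h1 : q * |∑ g ∈ G, ψ g| ≤ E * (M * √q) + 2 * n * E := by
      refine htot.trans ?_
      have h3 : (bad.card : ℝ) * q ≤ 2 * n * E :=
        calc (bad.card : ℝ) * q ≤ 2 * n * (E / q) * q := by gcongr
          _ = 2 * n * E := by field_simp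
      rw [hGcard]
      linarith
    have h2 : √q * (|∑ g ∈ G, ψ g| * √q) ≤ √q * ((M + 2 * n) * E) := by
      calc √q * (|∑ g ∈ G, ψ g| * √q) = (√q * √q) * |∑ g ∈ G, ψ g| := by ring
        _ ≤ E * (M * √q) + 2 * n * E := by rw [hs]; exact h1
        _ ≤ E * (M * √q) + 2 * n * E * √q :=
            add_le_add_right (le_mul_of_one_le_right (by positivity) hs1) _
        _ = _ := by ring
    exact le_of_mul_le_mul_left h2 (by positivity)
  calc _ = |∑ g ∈ G, ψ g| := rfl
    _ ≤ (M + 2 * n) * E / √q := hfin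
    _ = _ := by rw [hE]; field_simp

end Lines

section Bad

variable {K : Type*} [Field K] [Fintype K]

open Classical in
theorem card_monics_filter_sub_sq_le (hq : Odd (Fintype.card K)) (F : K[X]) {j : ℕ} (hj : 1 ≤ j) :
    ((monics K j).filter fun w => F - w ^ 2 ∈ monics K (2 * j - 1)).card ≤
      Fintype.card K ^ (j - 1) := by
  rw [← card_monics]
  set S := (monics K j).filter fun w => F - w ^ 2 ∈ monics K (2 * j - 1) with hS
  rcases S.eq_empty_or_nonempty with h | ⟨w₀, hw₀⟩
  · simp [h]
  have hw₀' := Finset.mem_filter.mp hw₀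
  have hm₀ := mem_monics.mp hw₀'.1
  refine Finset.card_le_card_of_injOn (fun w => X ^ (j - 1) + (w - w₀)) ?_ ?_
  · intro w hw
    have hw' := Finset.mem_filter.mp hw
    have hm := mem_monics.mp hw'.1
    refine add_mem_monics (mem_monics.mpr ⟨monic_X_pow _, natDegree_X_pow _⟩) ?_
    have h1 : (w - w₀) * (w + w₀) = (F - w₀ ^ 2) - (F - w ^ 2) := by ring
    have ha := mem_monics.mp hw₀'.2
    have hb := mem_monics.mp hw'.2
    have h2 : ((F - w₀ ^ 2) - (F - w ^ 2)).degree < ((2 * j - 1 : ℕ) : WithBot ℕ) := by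
      have h3 : (F - w₀ ^ 2).degree = ((2 * j - 1 : ℕ) : WithBot ℕ) := by
        rw [degree_eq_natDegree ha.1.ne_zero, ha.2]
      have h4 : (F - w ^ 2).degree = ((2 * j - 1 : ℕ) : WithBot ℕ) := by
        rw [degree_eq_natDegree hb.1.ne_zero, hb.2]
      rw [← h3]
      exact degree_sub_lt_left (h3.trans h4.symm) ha.1.ne_zero
        (by rw [ha.1.leadingCoeff, hb.1.leadingCoeff])
    have h5 : (w + w₀).degree = (j : WithBot ℕ) := by
      refine degree_eq_of_le_of_coeff_ne_zero ?_ ?_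
      · refine (degree_add_le _ _).trans (max_le ?_ ?_)
        · rw [degree_eq_natDegree hm.1.ne_zero, hm.2]
        · rw [degree_eq_natDegree hm₀.1.ne_zero, hm₀.2]
      · have h6 := hm.1.coeff_natDegree
        have h7 := hm₀.1.coeff_natDegree
        rw [hm.2] at h6
        rw [hm₀.2] at h7
        rw [coeff_add, h6, h7, one_add_one_eq_two]
        exact two_ne_zero_of_odd_card hq
    rw [← h1, degree_mul, h5] at h2
    by_cases h0 : w - w₀ = 0
    · rw [h0, degree_zero]; exact WithBot.bot_lt_coe _
    · rw [degree_eq_natDegree h0] at h2 ⊢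
      norm_cast at h2 ⊢
      omega
  · intro w _ w' _ h
    simpa using h

open Classical in
theorem card_biUnion_sq_dvd_le (n : ℕ) {j : ℕ} (hj : 1 ≤ j) :
    (((monics K j).biUnion fun p => (monics K n).filter fun g => p ^ 2 ∣ g).card : ℝ) ≤
      (Fintype.card K : ℝ) ^ n / Fintype.card K := by
  have hq0 : (0 : ℝ) < Fintype.card K := by exact_mod_cast Fintype.card_pos
  have hq1 : (1 : ℝ) ≤ Fintype.card K := by exact_mod_cast Fintype.card_pos
  calc _ ≤ ((∑ p ∈ monics K j, ((monics K n).filter fun g => p ^ 2 ∣ g).card : ℕ) : ℝ) := by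
        exact_mod_cast Finset.card_biUnion_le
    _ ≤ ∑ p ∈ monics K j, (Fintype.card K : ℝ) ^ n / (Fintype.card K : ℝ) ^ (2 * j) := by
        rw [Nat.cast_sum]
        refine Finset.sum_le_sum fun p hp => ?_
        have hp := mem_monics.mp hp
        have := card_monics_filter_dvd_le (hp.1.pow 2) n
        rwa [hp.1.natDegree_pow, hp.2] at this
    _ = (Fintype.card K : ℝ) ^ n / (Fintype.card K : ℝ) ^ j := by
        rw [Finset.sum_const, card_monics, nsmul_eq_mul, Nat.cast_pow, two_mul, pow_add]
        field_simp
    _ ≤ _ := by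
        gcongr
        exact le_self_pow₀ hq1 (by omega)

open Classical in
theorem card_biUnion_sq_dvd_sub_le (hq : Odd (Fintype.card K)) {n : ℕ} {F : K[X]}
    (hF : F ∈ monics K n) (hn : n ≠ 0) {j : ℕ} (hj : 1 ≤ j) :
    (((monics K j).biUnion fun p => (monics K (n - 1)).filter fun g => p ^ 2 ∣ F - g).card : ℝ) ≤
      (Fintype.card K : ℝ) ^ (n - 1) / Fintype.card K := by
  have hq0 : (0 : ℝ) < Fintype.card K := by exact_mod_cast Fintype.card_pos
  have hq1 : (1 : ℝ) ≤ Fintype.card K := by exact_mod_cast Fintype.card_pos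
  rcases lt_trichotomy (2 * j) n with h | h | h
  · calc _ ≤ ((∑ p ∈ monics K j, ((monics K (n - 1)).filter fun g =>
          p ^ 2 ∣ F - g).card : ℕ) : ℝ) := by
          exact_mod_cast Finset.card_biUnion_le
      _ = ∑ p ∈ monics K j, (Fintype.card K : ℝ) ^ (n - 1) / (Fintype.card K : ℝ) ^ (2 * j) := by
          rw [Nat.cast_sum]
          refine Finset.sum_congr rfl fun p hp => ?_
          have hp := mem_monics.mp hp
          have hd : (p ^ 2).natDegree = 2 * j := by rw [hp.1.natDegree_pow, hp.2]
          have := card_monics_filter_dvd_sub (hp.1.pow 2) F (n := n - 1) (by omega)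
          simp_rw [dvd_sub_comm (a := p ^ 2) (b := F)]
          rw [this, hd, Nat.cast_pow, pow_sub₀ _ hq0.ne' (by omega), div_eq_mul_inv]
      _ = (Fintype.card K : ℝ) ^ (n - 1) / (Fintype.card K : ℝ) ^ j := by
          rw [Finset.sum_const, card_monics, nsmul_eq_mul, Nat.cast_pow, two_mul, pow_add]
          field_simp
      _ ≤ _ := by
          gcongr
          exact le_self_pow₀ hq1 (by omega)
  · have hsub : ((monics K j).biUnion fun p => (monics K (n - 1)).filter fun g => p ^ 2 ∣ F - g) ⊆
        ((monics K j).filter fun w => F - w ^ 2 ∈ monics K (2 * j - 1)).image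
          fun w => F - w ^ 2 := by
      intro g hg
      obtain ⟨p, hp, hg⟩ := Finset.mem_biUnion.mp hg
      obtain ⟨hg, hd⟩ := Finset.mem_filter.mp hg
      have hFg := mem_monics.mp (sub_mem_monics hF hn hg)
      have hp' := mem_monics.mp hp
      have heq : p ^ 2 = F - g := by
        refine (eq_of_monic_of_dvd_of_natDegree_le (hp'.1.pow 2) hFg.1 hd ?_).symm
        rw [hp'.1.natDegree_pow, hp'.2, hFg.2, h]
      have hg' : F - p ^ 2 = g := by rw [heq]; ring
      refine Finset.mem_image.mpr ⟨p, Finset.mem_filter.mpr ⟨hp, ?_⟩, hg'⟩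
      rw [hg', h]
      exact hg
    have h1 := (Finset.card_le_card hsub).trans
      (Finset.card_image_le.trans (card_monics_filter_sub_sq_le hq F hj))
    calc _ ≤ ((Fintype.card K ^ (j - 1) : ℕ) : ℝ) := by exact_mod_cast h1
      _ ≤ (Fintype.card K : ℝ) ^ (n - 2) := by
          rw [Nat.cast_pow]
          exact pow_le_pow_right₀ hq1 (by omega)
      _ = _ := by
          rw [eq_div_iff hq0.ne', ← pow_succ]
          congr 1
          omega
  · have : ((monics K j).biUnion fun p =>
        (monics K (n - 1)).filter fun g => p ^ 2 ∣ F - g) = ∅ := by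
      refine Finset.eq_empty_of_forall_notMem fun g hg => ?_
      obtain ⟨p, hp, hg⟩ := Finset.mem_biUnion.mp hg
      obtain ⟨hg, hd⟩ := Finset.mem_filter.mp hg
      have hFg := mem_monics.mp (sub_mem_monics hF hn hg)
      have hp := mem_monics.mp hp
      have := natDegree_le_of_dvd hd hFg.1.ne_zero
      rw [hp.1.natDegree_pow, hp.2, hFg.2] at this
      omega
    rw [this, Finset.card_empty, Nat.cast_zero]
    positivity

theorem squarefree_of_forall_monic {K : Type*} [Field K] {f : K[X]} (hf : f ≠ 0)
    (h : ∀ p : K[X], p.Monic → 1 ≤ p.natDegree → ¬p ^ 2 ∣ f) : Squarefree f := by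
  intro x hx
  by_contra hu
  have hx0 : x ≠ 0 := by rintro rfl; simp at hx; exact hf hx
  obtain ⟨p, hp, hpi, hpx⟩ := exists_monic_irreducible_dvd hx0 hu
  exact h p hp hpi.natDegree_pos ((pow_two p).symm ▸ (mul_dvd_mul hpx hpx).trans hx)

theorem isCoprime_of_forall_monic {K : Type*} [Field K] {f g : K[X]} (hf : f ≠ 0)
    (h : ∀ p : K[X], p.Monic → 1 ≤ p.natDegree → p ∣ f → ¬p ∣ g) : IsCoprime f g := by
  classical
  rw [← EuclideanDomain.gcd_isUnit_iff]
  by_contra hu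
  have h0 : EuclideanDomain.gcd f g ≠ 0 := fun h' => hf (EuclideanDomain.gcd_eq_zero_iff.mp h').1
  obtain ⟨p, hp, hpi, hpd⟩ := exists_monic_irreducible_dvd h0 hu
  exact h p hp hpi.natDegree_pos (hpd.trans (EuclideanDomain.gcd_dvd_left f g))
    (hpd.trans (EuclideanDomain.gcd_dvd_right f g))

open Classical in
/-- The `g` for which `g * (F - g)` is not squarefree or not coprime to `F`. -/
noncomputable def degenerateSet (n : ℕ) (F : K[X]) : Finset K[X] :=
  (monics K (n - 1)).filter fun g => ¬(Squarefree (g * (F - g)) ∧ IsCoprime (g * (F - g)) F)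

theorem card_degenerateSet_le (hq : Odd (Fintype.card K)) {n : ℕ} {F : K[X]}
    (hF : F ∈ monics K n) (hn : n ≠ 0) :
    ((degenerateSet n F).card : ℝ) ≤
      3 * 2 ^ n * ((Fintype.card K : ℝ) ^ (n - 1) / Fintype.card K) := by
  classical
  have hq0 : (0 : ℝ) < Fintype.card K := by exact_mod_cast Fintype.card_pos
  have hq1 : (1 : ℝ) ≤ Fintype.card K := by exact_mod_cast Fintype.card_pos
  set E : ℝ := (Fintype.card K : ℝ) ^ (n - 1) / Fintype.card K with hE
  have hE0 : 0 ≤ E := by positivity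
  let S₁ : ℕ → Finset K[X] := fun j =>
    (monics K (j + 1)).biUnion fun p => (monics K (n - 1)).filter fun g => p ^ 2 ∣ g
  let S₂ : ℕ → Finset K[X] := fun j =>
    (monics K (j + 1)).biUnion fun p => (monics K (n - 1)).filter fun g => p ^ 2 ∣ F - g
  let S₃ : K[X] → Finset K[X] := fun p => (monics K (n - 1)).filter fun g => p ∣ g
  let T := (monicDivisors F).filter fun p => 1 ≤ p.natDegree
  have hFm := mem_monics.mp hF
  have hsub : degenerateSet n F ⊆
      (Finset.range n).biUnion S₁ ∪ (Finset.range n).biUnion S₂ ∪ T.biUnion S₃ := by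
    intro g hg
    obtain ⟨hg, hbad⟩ := Finset.mem_filter.mp hg
    have hgm := mem_monics.mp hg
    have hhm := mem_monics.mp (sub_mem_monics hF hn hg)
    by_contra hnot
    simp only [Finset.mem_union, not_or, Finset.mem_biUnion, not_exists, not_and] at hnot
    obtain ⟨⟨h1, h2⟩, h3⟩ := hnot
    have hgsq : Squarefree g := by
      refine squarefree_of_forall_monic hgm.1.ne_zero fun p hp hpd hd => ?_
      have := natDegree_le_of_dvd hd hgm.1.ne_zero
      rw [hp.natDegree_pow, hgm.2] at this
      exact h1 (p.natDegree - 1) (Finset.mem_range.mpr (by omega)) (Finset.mem_biUnion.mpr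
        ⟨p, mem_monics.mpr ⟨hp, by omega⟩, Finset.mem_filter.mpr ⟨hg, hd⟩⟩)
    have hhsq : Squarefree (F - g) := by
      refine squarefree_of_forall_monic hhm.1.ne_zero fun p hp hpd hd => ?_
      have := natDegree_le_of_dvd hd hhm.1.ne_zero
      rw [hp.natDegree_pow, hhm.2] at this
      exact h2 (p.natDegree - 1) (Finset.mem_range.mpr (by omega)) (Finset.mem_biUnion.mpr
        ⟨p, mem_monics.mpr ⟨hp, by omega⟩, Finset.mem_filter.mpr ⟨hg, hd⟩⟩)
    have hgF : IsCoprime g F := by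
      refine isCoprime_of_forall_monic hgm.1.ne_zero fun p hp hpd hd hdF => ?_
      exact h3 p (Finset.mem_filter.mpr ⟨(mem_monicDivisors hFm.1.ne_zero).mpr ⟨hp, hdF⟩, hpd⟩)
        (Finset.mem_filter.mpr ⟨hg, hd⟩)
    have hgh : IsCoprime g (F - g) := by
      have := hgF.add_mul_left_right (-1)
      rwa [mul_neg_one, ← sub_eq_add_neg] at this
    have hhF : IsCoprime (F - g) F := by
      have := hgh.symm.add_mul_left_right 1
      rwa [mul_one, add_sub_cancel] at this
    exact hbad ⟨squarefree_mul_iff.mpr ⟨hgh.isRelPrime, hgsq, hhsq⟩, hgF.mul_left hhF⟩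
  have c1 : (((Finset.range n).biUnion S₁).card : ℝ) ≤ n * E := by
    calc _ ≤ ((∑ j ∈ Finset.range n, (S₁ j).card : ℕ) : ℝ) := by
          exact_mod_cast Finset.card_biUnion_le
      _ ≤ ∑ j ∈ Finset.range n, E := by
          rw [Nat.cast_sum]
          exact Finset.sum_le_sum fun j _ => card_biUnion_sq_dvd_le (n - 1) (by omega)
      _ = n * E := by simp
  have c2 : (((Finset.range n).biUnion S₂).card : ℝ) ≤ n * E := by
    calc _ ≤ ((∑ j ∈ Finset.range n, (S₂ j).card : ℕ) : ℝ) := by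
          exact_mod_cast Finset.card_biUnion_le
      _ ≤ ∑ j ∈ Finset.range n, E := by
          rw [Nat.cast_sum]
          exact Finset.sum_le_sum fun j _ => card_biUnion_sq_dvd_sub_le hq hF hn (by omega)
      _ = n * E := by simp
  have c3 : ((T.biUnion S₃).card : ℝ) ≤ 2 ^ n * E := by
    calc _ ≤ ((∑ p ∈ T, (S₃ p).card : ℕ) : ℝ) := by exact_mod_cast Finset.card_biUnion_le
      _ ≤ ∑ p ∈ T, E := by
          rw [Nat.cast_sum]
          refine Finset.sum_le_sum fun p hp => ?_
          obtain ⟨hp, hpd⟩ := Finset.mem_filter.mp hp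
          refine (card_monics_filter_dvd_le ((mem_monicDivisors hFm.1.ne_zero).mp hp).1 _).trans ?_
          rw [hE]
          gcongr
          exact le_self_pow₀ hq1 (by omega)
      _ = T.card * E := by simp
      _ ≤ 2 ^ n * E := by
          gcongr
          have := (Finset.card_filter_le (monicDivisors F) fun p => 1 ≤ p.natDegree).trans
            (card_monicDivisors_le hFm.1)
          rw [hFm.2] at this
          exact_mod_cast this
  have hn2 : (n : ℝ) ≤ 2 ^ n := by exact_mod_cast Nat.lt_two_pow_self.le
  calc ((degenerateSet n F).card : ℝ) ≤
      (((Finset.range n).biUnion S₁).card + ((Finset.range n).biUnion S₂).card +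
        (T.biUnion S₃).card : ℕ) := by
        exact_mod_cast (Finset.card_le_card hsub).trans ((Finset.card_union_le _ _).trans
          (Nat.add_le_add_right (Finset.card_union_le _ _) _))
    _ ≤ n * E + n * E + 2 ^ n * E := by push_cast; linarith
    _ ≤ 2 ^ n * E + 2 ^ n * E + 2 ^ n * E := by gcongr
    _ = _ := by ring

end Bad

section Goldbach

variable {K : Type*} [Field K] [Fintype K]

theorem squarefree_neg_iff {R : Type*} [CommRing R] {a : R} : Squarefree (-a) ↔ Squarefree a :=
  (Associated.neg_left (Associated.refl a)).squarefree_iff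

open Classical in
theorem abs_sum_weighted_le {n : ℕ} {F : K[X]} (hF : F ∈ monics K n) (hn : n ≠ 0)
    (hqn : n ≤ Fintype.card K) (κ φ : K[X] → K[X] → ℝ) (hκ : ∀ u v, |κ u v| ≤ n ^ 2)
    (hφ : ∀ x y, |φ x y| ≤ 1)
    (hline : ∀ u v, u.Monic → v.Monic → Squarefree (u * v) → κ u v ≠ 0 →
      ∃ k, u.natDegree + v.natDegree + k + 1 < n ∧
        ∀ ℓ x y : K[X], ℓ.natDegree = k → Squarefree (u * v * ℓ) → x.Monic → y.Monic →
        u.natDegree + x.natDegree + 1 = n → v.natDegree + y.natDegree = n →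
        IsCoprime x (v * ℓ) → IsCoprime y (u * ℓ) →
        |∑ s : K, φ (x + C s * (v * ℓ)) (y + C s * (-(u * ℓ)))| ≤
          400 * n * √(Fintype.card K : ℝ)) :
    |∑ g ∈ monics K (n - 1), ∑ u ∈ monicDivisors g, ∑ v ∈ monicDivisors (F - g),
        if Squarefree (u * v) ∧ IsCoprime (u * v) F then
          κ u v * φ (g /ₘ u) ((F - g) /ₘ v) else 0| ≤
      n * (n + 1) * (402 * n ^ 3 *
        ((Fintype.card K : ℝ) ^ (n - 1) / √(Fintype.card K : ℝ))) := by
  have hq0 : (0 : ℝ) < Fintype.card K := by exact_mod_cast Fintype.card_pos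
  refine abs_sum_dvdClass_total_le hF hn _ fun u v hu hv => ?_
  by_cases hgood : Squarefree (u * v) ∧ IsCoprime (u * v) F
  · simp only [if_pos hgood]
    rw [← Finset.mul_sum]
    by_cases h0 : κ u v = 0
    · rw [h0, zero_mul, abs_zero]; positivity
    obtain ⟨k, hk, hl⟩ := hline u v hu hv hgood.1 h0
    have h := abs_sum_dvdClass_le hF hn hu hv hgood.1 hgood.2 hqn k hk φ hφ
      (M := 400 * n) (by positivity) hl
    rw [abs_mul]
    calc _ ≤ (n : ℝ) ^ 2 * _ := mul_le_mul (hκ u v) h (abs_nonneg _) (by positivity)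
      _ = _ := by ring
  · simp only [if_neg hgood, Finset.sum_const_zero, abs_zero]
    positivity

variable [DecidableEq K]

open Classical in
theorem abs_sum_polyMu_left_le (hq : Odd (Fintype.card K)) {n m : ℕ} {F : K[X]}
    (hF : F ∈ monics K n) (hn : n ≠ 0) (hqn : n ≤ Fintype.card K) (hm : m ≤ n) :
    |∑ g ∈ monics K (n - 1), ∑ u ∈ monicDivisors g, ∑ v ∈ monicDivisors (F - g),
        if Squarefree (u * v) ∧ IsCoprime (u * v) F then
          (((n - 1 - m - u.natDegree : ℕ) : ℝ) * (polyMu v * ((m - v.natDegree : ℕ) : ℝ))) *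
            polyMu (g /ₘ u) else 0| ≤
      n * (n + 1) * (402 * n ^ 3 *
        ((Fintype.card K : ℝ) ^ (n - 1) / √(Fintype.card K : ℝ))) := by
  refine abs_sum_weighted_le hF hn hqn (fun u v => ((n - 1 - m - u.natDegree : ℕ) : ℝ) *
    (polyMu v * ((m - v.natDegree : ℕ) : ℝ))) (fun x _ => polyMu x) ?_ ?_ ?_
  · intro u v
    have h1 : ((n - 1 - m - u.natDegree : ℕ) : ℝ) ≤ n := by exact_mod_cast (by omega)
    have h2 : ((m - v.natDegree : ℕ) : ℝ) ≤ n := by exact_mod_cast (by omega)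
    have h3 := abs_polyMu_le_one_real v
    rw [abs_mul, abs_mul, Nat.abs_cast, Nat.abs_cast]
    calc _ ≤ (n : ℝ) * (1 * n) := by gcongr
      _ = n ^ 2 := by ring
  · exact fun x _ => abs_polyMu_le_one_real x
  · intro u v hu hv hsq h0
    have ha : n - 1 - m - u.natDegree ≠ 0 := by rintro h; simp [h] at h0
    have hc : m - v.natDegree ≠ 0 := by rintro h; simp [h] at h0
    refine ⟨n - 3 - u.natDegree - v.natDegree, by omega, ?_⟩
    intro ℓ x y hℓ hsqℓ hx hy hdx hdy hcx hcy
    rw [mul_assoc] at hsqℓ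
    have hB := hsqℓ.of_mul_right
    have hd := natDegree_mul (left_ne_zero_of_mul hB.ne_zero) (right_ne_zero_of_mul hB.ne_zero)
    refine (abs_sum_polyMu_line_le hq hx hB hcx (by omega)).trans ?_
    have : (x.natDegree : ℝ) ≤ n := by exact_mod_cast (by omega)
    gcongr
    norm_num

open Classical in
theorem abs_sum_polyMu_right_le (hq : Odd (Fintype.card K)) {n m : ℕ} {F : K[X]}
    (hF : F ∈ monics K n) (hn : n ≠ 0) (hqn : n ≤ Fintype.card K) (hm : m ≤ n) :
    |∑ g ∈ monics K (n - 1), ∑ u ∈ monicDivisors g, ∑ v ∈ monicDivisors (F - g),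
        if Squarefree (u * v) ∧ IsCoprime (u * v) F then
          ((polyMu u * ((m - u.natDegree : ℕ) : ℝ)) * ((n - m - v.natDegree : ℕ) : ℝ)) *
            polyMu ((F - g) /ₘ v) else 0| ≤
      n * (n + 1) * (402 * n ^ 3 *
        ((Fintype.card K : ℝ) ^ (n - 1) / √(Fintype.card K : ℝ))) := by
  refine abs_sum_weighted_le hF hn hqn (fun u v => (polyMu u * ((m - u.natDegree : ℕ) : ℝ)) *
    ((n - m - v.natDegree : ℕ) : ℝ)) (fun _ y => polyMu y) ?_ ?_ ?_
  · intro u v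
    have h1 : ((m - u.natDegree : ℕ) : ℝ) ≤ n := by exact_mod_cast (by omega)
    have h2 : ((n - m - v.natDegree : ℕ) : ℝ) ≤ n := by exact_mod_cast (by omega)
    have h3 := abs_polyMu_le_one_real u
    rw [abs_mul, abs_mul, Nat.abs_cast, Nat.abs_cast]
    calc _ ≤ (1 * (n : ℝ)) * n := by gcongr
      _ = n ^ 2 := by ring
  · exact fun _ y => abs_polyMu_le_one_real y
  · intro u v hu hv hsq h0
    have ha : m - u.natDegree ≠ 0 := by rintro h; simp [h] at h0
    have hc : n - m - v.natDegree ≠ 0 := by rintro h; simp [h] at h0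
    refine ⟨n - 2 - u.natDegree - v.natDegree, by omega, ?_⟩
    intro ℓ x y hℓ hsqℓ hx hy hdx hdy hcx hcy
    rw [mul_comm u v, mul_assoc] at hsqℓ
    have hB := hsqℓ.of_mul_right
    have hd := natDegree_mul (left_ne_zero_of_mul hB.ne_zero) (right_ne_zero_of_mul hB.ne_zero)
    refine (abs_sum_polyMu_line_le hq hy (squarefree_neg_iff.mpr hB) hcy.neg_right
      (by rw [natDegree_neg]; omega)).trans ?_
    have : (y.natDegree : ℝ) ≤ n := by exact_mod_cast (by omega)
    gcongr
    norm_num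

open Classical in
theorem abs_sum_polyMu_mul_polyMu_le (hq : Odd (Fintype.card K)) {n m : ℕ} {F : K[X]}
    (hF : F ∈ monics K n) (hn : n ≠ 0) (hqn : n ≤ Fintype.card K) (hm : n ≤ 2 * m + 1) :
    |∑ g ∈ monics K (n - 1), ∑ u ∈ monicDivisors g, ∑ v ∈ monicDivisors (F - g),
        if Squarefree (u * v) ∧ IsCoprime (u * v) F then
          (((n - 1 - m - u.natDegree : ℕ) : ℝ) * ((n - m - v.natDegree : ℕ) : ℝ)) *
            (polyMu (g /ₘ u) * polyMu ((F - g) /ₘ v)) else 0| ≤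
      n * (n + 1) * (402 * n ^ 3 *
        ((Fintype.card K : ℝ) ^ (n - 1) / √(Fintype.card K : ℝ))) := by
  refine abs_sum_weighted_le hF hn hqn (fun u v => ((n - 1 - m - u.natDegree : ℕ) : ℝ) *
    ((n - m - v.natDegree : ℕ) : ℝ)) (fun x y => polyMu x * polyMu y) ?_ ?_ ?_
  · intro u v
    have h1 : ((n - 1 - m - u.natDegree : ℕ) : ℝ) ≤ n := by exact_mod_cast (by omega)
    have h2 : ((n - m - v.natDegree : ℕ) : ℝ) ≤ n := by exact_mod_cast (by omega)
    rw [abs_mul, Nat.abs_cast, Nat.abs_cast, pow_two]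
    gcongr
  · intro x y
    rw [abs_mul]
    exact mul_le_one₀ (abs_polyMu_le_one_real x) (abs_nonneg _) (abs_polyMu_le_one_real y)
  · intro u v hu hv hsq h0
    have ha : n - 1 - m - u.natDegree ≠ 0 := by rintro h; simp [h] at h0
    have hc : n - m - v.natDegree ≠ 0 := by rintro h; simp [h] at h0
    refine ⟨n - 2 - u.natDegree - v.natDegree, by omega, ?_⟩
    intro ℓ x y hℓ hsqℓ hx hy hdx hdy hcx hcy
    have hB : Squarefree (v * ℓ) := by rw [mul_assoc] at hsqℓ; exact hsqℓ.of_mul_right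
    have hB' : Squarefree (u * ℓ) := by
      rw [mul_comm u v, mul_assoc] at hsqℓ; exact hsqℓ.of_mul_right
    have hd := natDegree_mul (left_ne_zero_of_mul hB.ne_zero) (right_ne_zero_of_mul hB.ne_zero)
    have hd' := natDegree_mul (left_ne_zero_of_mul hB'.ne_zero) (right_ne_zero_of_mul hB'.ne_zero)
    refine (abs_sum_polyMu_mul_polyMu_line_le hq hx hB hcx (by omega) hy
      (squarefree_neg_iff.mpr hB') hcy.neg_right (by rw [natDegree_neg]; omega)).trans ?_
    have : (x.natDegree : ℝ) + y.natDegree ≤ 2 * n := by exact_mod_cast (by omega)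
    calc _ ≤ 200 * (2 * (n : ℝ)) * √(Fintype.card K : ℝ) := by gcongr
      _ = _ := by ring

end Goldbach

section Count

variable {K : Type*} [Field K] [Fintype K] [DecidableEq K]

theorem mangoldt_eq_zero_of_squarefree (hq : Odd (Fintype.card K)) (m : ℕ) {f : K[X]}
    (hf : f.Monic) (h1 : f ≠ 1) (hsq : Squarefree f) (hirr : ¬Irreducible f) :
    mangoldt m f = 0 := by
  refine (mangoldt_eq_zero_or hq m hf h1 hirr).resolve_right ?_
  rintro ⟨P, k, hP, hk, rfl⟩
  have hu : IsUnit P := hsq P (by rw [← pow_two]; exact pow_dvd_pow P hk)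
  exact h1 (by rw [hP.eq_one_of_isUnit hu, one_pow])

open Classical in
theorem mangoldt_mul_mangoldt_eq (hq : Odd (Fintype.card K)) (m : ℕ) {f h : K[X]}
    (hf : f.Monic) (hh : h.Monic) (hf1 : f ≠ 1) (hh1 : h ≠ 1) (hfs : Squarefree f)
    (hhs : Squarefree h) :
    mangoldt m f * mangoldt m h =
      if Irreducible f ∧ Irreducible h then (f.natDegree : ℤ) * h.natDegree else 0 := by
  by_cases hfi : Irreducible f
  · by_cases hhi : Irreducible h
    · rw [if_pos ⟨hfi, hhi⟩, mangoldt_irreducible hq m hf hfi, mangoldt_irreducible hq m hh hhi]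
    · rw [if_neg fun h => hhi h.2, mangoldt_eq_zero_of_squarefree hq m hh hh1 hhs hhi, mul_zero]
  · rw [if_neg fun h => hfi h.1, mangoldt_eq_zero_of_squarefree hq m hf hf1 hfs hfi, zero_mul]

open Classical in
/-- The `g` of degree `n - 1` which give a Goldbach representation of `F`. -/
noncomputable def goldbachSet {K : Type*} [Field K] [Fintype K] (n : ℕ) (F : K[X]) :
    Finset K[X] :=
  (monics K (n - 1)).filter fun g => Irreducible g ∧ Irreducible (F - g)

open Classical in
theorem abs_goldbach_sub_le (hq : Odd (Fintype.card K)) {n : ℕ} {F : K[X]}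
    (hF : F ∈ monics K n) (hn : 2 ≤ n) (hqn : n ≤ Fintype.card K) :
    |n * (n - 1) * ((goldbachSet n F).card : ℝ) - (Fintype.card K : ℝ) ^ (n - 1)| ≤
      (15 * n ^ 2 * 8 ^ n + 1207 * n ^ 4 * (n + 1)) *
        ((Fintype.card K : ℝ) ^ (n - 1) / √(Fintype.card K : ℝ)) := by
  have hn0 : n ≠ 0 := by omega
  set q : ℝ := (Fintype.card K : ℝ) with hqdef
  set m := n / 2 with hm
  let Ψ₀ : K[X] → K[X] → K[X] → ℝ := fun u v _ => if IsCoprime u v then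
    (polyMu u : ℝ) * ((m - u.natDegree : ℕ) : ℝ) * (polyMu v * ((m - v.natDegree : ℕ) : ℝ)) else 0
  let Ψ₁ : K[X] → K[X] → K[X] → ℝ := fun u v g => if Squarefree (u * v) ∧ IsCoprime (u * v) F then
    (((n - 1 - m - u.natDegree : ℕ) : ℝ) * (polyMu v * ((m - v.natDegree : ℕ) : ℝ))) *
            polyMu (g /ₘ u) else 0
  let Ψ₂ : K[X] → K[X] → K[X] → ℝ := fun u v g => if Squarefree (u * v) ∧ IsCoprime (u * v) F then
    ((polyMu u * ((m - u.natDegree : ℕ) : ℝ)) * ((n - m - v.natDegree : ℕ) : ℝ)) *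
            polyMu ((F - g) /ₘ v) else 0
  let Ψ₃ : K[X] → K[X] → K[X] → ℝ := fun u v g => if Squarefree (u * v) ∧ IsCoprime (u * v) F then
    (((n - 1 - m - u.natDegree : ℕ) : ℝ) * ((n - m - v.natDegree : ℕ) : ℝ)) *
            (polyMu (g /ₘ u) * polyMu ((F - g) /ₘ v)) else 0
  let S : (K[X] → K[X] → K[X] → ℝ) → K[X] → ℝ := fun Ψ g =>
    ∑ u ∈ monicDivisors g, ∑ v ∈ monicDivisors (F - g), Ψ u v g
  let I : K[X] → ℝ := fun g => if Irreducible g ∧ Irreducible (F - g) then n * (n - 1) else 0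
  have e0 : |∑ g ∈ monics K (n - 1), S Ψ₀ g - q ^ (n - 1)| ≤ _ :=
    abs_sum_coprime_sub_le hq hF (m := m) (by omega) (by omega)
  have e1 : |∑ g ∈ monics K (n - 1), S Ψ₁ g| ≤ _ :=
    abs_sum_polyMu_left_le hq hF hn0 hqn (m := m) (by omega)
  have e2 : |∑ g ∈ monics K (n - 1), S Ψ₂ g| ≤ _ :=
    abs_sum_polyMu_right_le hq hF hn0 hqn (m := m) (by omega)
  have e3 : |∑ g ∈ monics K (n - 1), S Ψ₃ g| ≤ _ :=
    abs_sum_polyMu_mul_polyMu_le hq hF hn0 hqn (m := m) (by omega)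
  have hD := card_degenerateSet_le hq hF hn0
  rw [← hqdef] at e0 e1 e2 e3 hD
  have hmon : ∀ g ∈ monics K (n - 1), F - g ∈ monics K n := fun g hg => sub_mem_monics hF hn0 hg
  have hgood : ∀ g ∈ monics K (n - 1), g ∉ degenerateSet n F →
      I g - (S Ψ₀ g - S Ψ₁ g - S Ψ₂ g + S Ψ₃ g) = 0 := by
    intro g hg hgd
    have hgm := mem_monics.mp hg
    have hhm := mem_monics.mp (hmon g hg)
    have hgd : Squarefree (g * (F - g)) ∧ IsCoprime (g * (F - g)) F := by
      by_contra h
      exact hgd (Finset.mem_filter.mpr ⟨hg, h⟩)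
    have hI : I g = (mangoldt m g : ℝ) * mangoldt m (F - g) := by
      rw [← Int.cast_mul, mangoldt_mul_mangoldt_eq hq m hgm.1 hhm.1
        (by rintro h; rw [h, natDegree_one] at hgm; omega)
        (by rintro h; rw [h, natDegree_one] at hhm; omega)
        hgd.1.of_mul_left hgd.1.of_mul_right, hgm.2, hhm.2]
      simp only [I]
      split_ifs
      · push_cast [Nat.cast_sub (by omega : 1 ≤ n)]; ring
      · simp
    rw [hI, mangoldt_eq_sum_truncated m hgm.1, mangoldt_eq_sum_truncated m hhm.1, hgm.2, hhm.2]
    push_cast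
    rw [sub_eq_zero, Finset.sum_mul_sum]
    simp only [S, ← Finset.sum_sub_distrib, ← Finset.sum_add_distrib]
    refine Finset.sum_congr rfl fun u hu => Finset.sum_congr rfl fun v hv => ?_
    have hdvd : u * v ∣ g * (F - g) :=
      mul_dvd_mul ((mem_monicDivisors hgm.1.ne_zero).mp hu).2
        ((mem_monicDivisors hhm.1.ne_zero).mp hv).2
    have h1 : Squarefree (u * v) := hgd.1.squarefree_of_dvd hdvd
    have h2 : IsCoprime (u * v) F := hgd.2.of_isCoprime_of_dvd_left hdvd
    have h3 : IsCoprime u v := (squarefree_mul_iff.mp h1).1.isCoprime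
    simp only [Ψ₀, Ψ₁, Ψ₂, Ψ₃, if_pos h3, if_pos (And.intro h1 h2)]
    ring
  have hbad : ∀ Ψ : K[X] → K[X] → K[X] → ℝ, (∀ u v g, |Ψ u v g| ≤ (n : ℝ) ^ 2) →
      ∑ g ∈ degenerateSet n F, |S Ψ g| ≤ (degenerateSet n F).card * (4 ^ n * (n : ℝ) ^ 2) :=
    fun Ψ hΨ => abs_sum_sum_monicDivisors_le hF hn0 _ (Finset.filter_subset _ _) Ψ
      (by positivity) hΨ
  have hw : ∀ (x y : ℝ) (a b : ℕ) (z : ℝ), |x| ≤ 1 → |y| ≤ 1 → a ≤ n → b ≤ n →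
      z = x * y * (a * b) → |z| ≤ (n : ℝ) ^ 2 := by
    rintro x y a b z hx hy ha hb rfl
    rw [abs_mul, abs_mul, abs_mul, Nat.abs_cast, Nat.abs_cast]
    calc |x| * |y| * (a * b) ≤ 1 * 1 * (n * n : ℝ) := by gcongr
      _ = _ := by ring
  have hμ := abs_polyMu_le_one_real (K := K)
  have hn2 : |(0 : ℝ)| ≤ (n : ℝ) ^ 2 := by rw [abs_zero]; positivity
  have b0 := hbad Ψ₀ fun u v g => by
    simp only [Ψ₀]
    split_ifs
    · exact hw _ _ (m - u.natDegree) (m - v.natDegree) _ (hμ u) (hμ v) (by omega) (by omega)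
        (by ring)
    · exact hn2
  have b1 := hbad Ψ₁ fun u v g => by
    simp only [Ψ₁]
    split_ifs
    · exact hw _ _ (n - 1 - m - u.natDegree) (m - v.natDegree) _ (hμ (g /ₘ u)) (hμ v) (by omega)
        (by omega) (by ring)
    · exact hn2
  have b2 := hbad Ψ₂ fun u v g => by
    simp only [Ψ₂]
    split_ifs
    · exact hw _ _ (m - u.natDegree) (n - m - v.natDegree) _ (hμ u) (hμ ((F - g) /ₘ v)) (by omega)
        (by omega) (by ring)
    · exact hn2
  have b3 := hbad Ψ₃ fun u v g => by
    simp only [Ψ₃]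
    split_ifs
    · exact hw _ _ (n - 1 - m - u.natDegree) (n - m - v.natDegree) _ (hμ (g /ₘ u))
        (hμ ((F - g) /ₘ v)) (by omega) (by omega) (by ring)
    · exact hn2
  have hn1 : (1 : ℝ) ≤ n := by exact_mod_cast (by omega : 1 ≤ n)
  have bI : ∑ g ∈ degenerateSet n F, |I g| ≤
      (degenerateSet n F).card * (4 ^ n * (n : ℝ) ^ 2) := by
    rw [← nsmul_eq_mul]
    refine Finset.sum_le_card_nsmul _ _ _ fun g _ => ?_
    have h4 : (1 : ℝ) ≤ 4 ^ n := one_le_pow₀ (by norm_num)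
    have h1 : |I g| ≤ 1 * (n : ℝ) ^ 2 := by
      simp only [I]
      split_ifs
      · rw [abs_of_nonneg (by nlinarith)]; nlinarith
      · rwa [one_mul]
    exact h1.trans (by gcongr)
  have hsplit : n * (n - 1) * ((goldbachSet n F).card : ℝ) - q ^ (n - 1) =
      ∑ g ∈ degenerateSet n F, (I g - (S Ψ₀ g - S Ψ₁ g - S Ψ₂ g + S Ψ₃ g)) +
      ((∑ g ∈ monics K (n - 1), S Ψ₀ g - q ^ (n - 1)) - ∑ g ∈ monics K (n - 1), S Ψ₁ g -
        ∑ g ∈ monics K (n - 1), S Ψ₂ g + ∑ g ∈ monics K (n - 1), S Ψ₃ g) := by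
    have hI : n * (n - 1) * ((goldbachSet n F).card : ℝ) = ∑ g ∈ monics K (n - 1), I g := by
      rw [← Finset.sum_filter, Finset.sum_const, nsmul_eq_mul, mul_comm]
      rfl
    rw [hI, Finset.sum_subset (s₁ := degenerateSet n F) (Finset.filter_subset _ _) hgood]
    simp only [Finset.sum_sub_distrib, Finset.sum_add_distrib]
    ring
  have hb : |∑ g ∈ degenerateSet n F, (I g - (S Ψ₀ g - S Ψ₁ g - S Ψ₂ g + S Ψ₃ g))| ≤
      (degenerateSet n F).card * (4 ^ n * (n : ℝ) ^ 2) * 5 := by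
    have h : ∑ g ∈ degenerateSet n F, |I g - (S Ψ₀ g - S Ψ₁ g - S Ψ₂ g + S Ψ₃ g)| ≤
        ∑ g ∈ degenerateSet n F, (|I g| + |S Ψ₀ g| + |S Ψ₁ g| + |S Ψ₂ g| + |S Ψ₃ g|) := by
      refine Finset.sum_le_sum fun g _ => ?_
      rw [abs_le]
      constructor <;>
      linarith [neg_abs_le (I g), le_abs_self (I g), neg_abs_le (S Ψ₀ g), le_abs_self (S Ψ₀ g),
        neg_abs_le (S Ψ₁ g), le_abs_self (S Ψ₁ g), neg_abs_le (S Ψ₂ g), le_abs_self (S Ψ₂ g),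
        neg_abs_le (S Ψ₃ g), le_abs_self (S Ψ₃ g)]
    simp only [Finset.sum_add_distrib] at h
    linarith [Finset.abs_sum_le_sum_abs
      (fun g => I g - (S Ψ₀ g - S Ψ₁ g - S Ψ₂ g + S Ψ₃ g)) (degenerateSet n F)]
  have hq1 : 1 ≤ q := by rw [hqdef]; exact_mod_cast Fintype.card_pos
  have hX : q ^ (n - 1) / q ≤ q ^ (n - 1) / √q := by
    have hs : √q ≤ q := Real.sqrt_le_iff.mpr ⟨by linarith, by nlinarith⟩
    have : 0 < √q := Real.sqrt_pos.mpr (by linarith)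
    gcongr
  set X := q ^ (n - 1) / √q with hXdef
  have hb' : (degenerateSet n F).card * (4 ^ n * (n : ℝ) ^ 2) * 5 ≤ 15 * n ^ 2 * 8 ^ n * X := by
    calc (degenerateSet n F).card * (4 ^ n * (n : ℝ) ^ 2) * 5
        ≤ (3 * 2 ^ n * X) * (4 ^ n * (n : ℝ) ^ 2) * 5 := by
          have := hD.trans (mul_le_mul_of_nonneg_left hX (by positivity))
          gcongr
      _ = 15 * n ^ 2 * (2 ^ n * 4 ^ n) * X := by ring
      _ = _ := by rw [← mul_pow]; norm_num
  have e0' : (n : ℝ) * (n + 1) * (n ^ 3 * (q ^ (n - 1) / q)) ≤ n * (n + 1) * (n ^ 3 * X) := by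
    gcongr
  rw [hsplit]
  have := abs_le.mp (hb.trans hb')
  have := abs_le.mp (e0.trans e0')
  have := abs_le.mp e1
  have := abs_le.mp e2
  have := abs_le.mp e3
  rw [abs_le]
  constructor <;> linarith

end Count

section Absorb

variable {K : Type*} [Field K] [Fintype K]

theorem goldbach_poly_factor_le {n : ℕ} (hn : 1 ≤ n) :
    (15 * n ^ 2 * 8 ^ n + 1207 * n ^ 4 * (n + 1) : ℝ) ≤
      2429 * Real.exp 32 * n.factorial * (n - 1).factorial := by
  have hn1 : (1 : ℝ) ≤ n := by exact_mod_cast hn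
  have h2 : (n : ℝ) ≤ 2 ^ n := by exact_mod_cast Nat.lt_two_pow_self.le
  have h32 : (32 : ℝ) ^ n ≤ Real.exp 32 * n.factorial :=
    (div_le_iff₀ (by positivity)).mp (Real.pow_div_factorial_le_exp 32 (by norm_num) n)
  have hfac : (1 : ℝ) ≤ (n - 1).factorial := by exact_mod_cast Nat.factorial_pos _
  have ha : (n : ℝ) ^ 2 * 8 ^ n ≤ 32 ^ n := by
    calc (n : ℝ) ^ 2 * 8 ^ n ≤ (2 ^ n) ^ 2 * 8 ^ n := by gcongr
      _ = 32 ^ n := by rw [← pow_mul, mul_comm n 2, pow_mul, ← mul_pow]; norm_num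
  have hb : (n : ℝ) ^ 4 * (n + 1) ≤ 2 * 32 ^ n := by
    calc (n : ℝ) ^ 4 * (n + 1) ≤ (n : ℝ) ^ 4 * (n + n) := by gcongr
      _ = 2 * (n : ℝ) ^ 5 := by ring
      _ ≤ 2 * (2 ^ n) ^ 5 := by gcongr
      _ = 2 * 32 ^ n := by rw [← pow_mul, mul_comm n 5, pow_mul]; norm_num
  calc (15 * n ^ 2 * 8 ^ n + 1207 * n ^ 4 * (n + 1) : ℝ) ≤ 2429 * 32 ^ n * 1 := by linarith
    _ ≤ 2429 * (Real.exp 32 * n.factorial) * (n - 1).factorial := by gcongr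
    _ = _ := by ring

theorem pow_sub_one_div_sqrt_eq_rpow {q : ℝ} (hq : 0 < q) {n : ℕ} (hn : 1 ≤ n) :
    q ^ (n - 1) / √q = q ^ ((n : ℝ) - 3 / 2) := by
  rw [Real.sqrt_eq_rpow, ← Real.rpow_natCast, ← Real.rpow_sub hq]
  push_cast [Nat.cast_sub hn]
  congr 1
  ring

theorem abs_card_goldbachSet_sub_le (hq : Odd (Fintype.card K)) {n : ℕ} {F : K[X]}
    (hF : F ∈ monics K n) (hn : 2 ≤ n) :
    |((goldbachSet n F).card : ℝ) - (Fintype.card K : ℝ) ^ (n - 1) / (n * (n - 1))| ≤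
      2429 * Real.exp 32 * n.factorial * (n - 1).factorial *
        (Fintype.card K : ℝ) ^ ((n : ℝ) - 3 / 2) := by
  classical
  have hq0 : (0 : ℝ) < Fintype.card K := by exact_mod_cast Fintype.card_pos
  have hn2 : (2 : ℝ) ≤ n := by exact_mod_cast hn
  have hN : (1 : ℝ) ≤ n * (n - 1) := by nlinarith
  rw [← pow_sub_one_div_sqrt_eq_rpow hq0 (by omega)]
  rcases le_or_gt n (Fintype.card K) with hqn | hqn
  · have h := abs_goldbach_sub_le hq hF hn hqn
    set Q : ℝ := (Fintype.card K : ℝ) ^ (n - 1)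
    have heq : ((goldbachSet n F).card : ℝ) - Q / (n * (n - 1)) =
        (n * (n - 1) * ((goldbachSet n F).card : ℝ) - Q) / (n * (n - 1)) := by
      rw [sub_div, mul_div_cancel_left₀ _ (by linarith)]
    rw [heq, abs_div, abs_of_pos (by linarith : (0 : ℝ) < n * (n - 1))]
    refine (div_le_self (abs_nonneg _) hN).trans (h.trans ?_)
    exact mul_le_mul_of_nonneg_right (goldbach_poly_factor_le (by omega)) (by positivity)
  · set Q : ℝ := (Fintype.card K : ℝ) ^ (n - 1) with hQ
    have hQ0 : 0 ≤ Q := by positivity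
    have hR : ((goldbachSet n F).card : ℝ) ≤ Q := by
      rw [hQ, ← Nat.cast_pow, ← card_monics]
      exact_mod_cast Finset.card_filter_le _ _
    have hR0 : (0 : ℝ) ≤ (goldbachSet n F).card := Nat.cast_nonneg _
    have hd : Q / (n * (n - 1)) ≤ Q := div_le_self hQ0 hN
    have hd0 : 0 ≤ Q / (n * (n - 1)) := div_nonneg hQ0 (by linarith)
    have hs : √(Fintype.card K : ℝ) ≤ 2429 * Real.exp 32 * n.factorial * (n - 1).factorial := by
      refine le_trans ?_ (goldbach_poly_factor_le (by omega))
      have h1 : √(Fintype.card K : ℝ) ≤ n := by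
        refine Real.sqrt_le_iff.mpr ⟨by linarith, ?_⟩
        have : (Fintype.card K : ℝ) ≤ n := by exact_mod_cast hqn.le
        nlinarith
      have h8 : (1 : ℝ) ≤ 8 ^ n := one_le_pow₀ (by norm_num)
      have h4 : (0 : ℝ) ≤ 1207 * n ^ 4 * (n + 1) := by positivity
      have h5 : (n : ℝ) ^ 2 * 1 ≤ n ^ 2 * 8 ^ n := by gcongr
      nlinarith
    have hsq : 0 < √(Fintype.card K : ℝ) := Real.sqrt_pos.mpr hq0
    calc |((goldbachSet n F).card : ℝ) - Q / (n * (n - 1))| ≤ Q := by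
          rw [abs_le]; constructor <;> linarith
      _ = √(Fintype.card K : ℝ) * (Q / √(Fintype.card K : ℝ)) := by field_simp
      _ ≤ _ := mul_le_mul_of_nonneg_right hs (by positivity)

end Absorb

/-- **Theorem 1 (Goldbach count).**  Let `F_q` be a finite field of odd order `q` and let
`F ∈ F_q[t]` be monic of degree `n ≥ 2`.  Then, with absolute constants `C₁, C₂ > 0`,
`|R(F;q) − q^(n−1)/(n(n−1))| ≤ C₁·n!·(n−1)!·q^(n−3/2) + C₂·n·2^(C(n+2,2))·q^(n−2)`,
where `R(F;q)` is the number of monic irreducible `g` of degree `n−1` such that `F − g`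
is monic irreducible. -/
theorem goldbach_count :
    ∃ C₁ C₂ : ℝ, 0 < C₁ ∧ 0 < C₂ ∧
      ∀ (Fq : Type) [Field Fq] [Fintype Fq], Odd (Fintype.card Fq) →
      ∀ (n : ℕ), 2 ≤ n → ∀ F : Polynomial Fq, F.Monic → F.natDegree = n →
      |(Nat.card {g : Polynomial Fq //
            g.Monic ∧ Irreducible g ∧ g.natDegree = n - 1 ∧
            (F - g).Monic ∧ Irreducible (F - g)} : ℝ)
          - (Fintype.card Fq : ℝ) ^ (n - 1) / (n * (n - 1))|
        ≤ C₁ * n.factorial * (n - 1).factorial *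
            (Fintype.card Fq : ℝ) ^ ((n : ℝ) - 3 / 2)
          + C₂ * n * 2 ^ (Nat.choose (n + 2) 2) * (Fintype.card Fq : ℝ) ^ (n - 2) := by
  refine ⟨2429 * Real.exp 32, 1, by positivity, one_pos, fun Fq _ _ hq n hn F hFm hFd => ?_⟩
  have hF : F ∈ monics Fq n := mem_monics.mpr ⟨hFm, hFd⟩
  have hcard : Nat.card {g : Polynomial Fq // g.Monic ∧ Irreducible g ∧ g.natDegree = n - 1 ∧
      (F - g).Monic ∧ Irreducible (F - g)} = (goldbachSet n F).card := by
    refine Nat.subtype_card _ fun g => ?_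
    simp only [goldbachSet, Finset.mem_filter, mem_monics]
    constructor
    · rintro ⟨⟨h1, h2⟩, h3, h4⟩
      exact ⟨h1, h3, h2, (mem_monics.mp (sub_mem_monics hF (by omega)
        (mem_monics.mpr ⟨h1, h2⟩))).1, h4⟩
    · rintro ⟨h1, h2, h3, -, h5⟩
      exact ⟨⟨h1, h3⟩, h2, h5⟩
  rw [hcard]
  exact (abs_card_goldbachSet_sub_le hq hF hn).trans (le_add_of_nonneg_right (by positivity))
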